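/- Let f : ℝ² → ℝ² be a differentiable map such that Spec(f) ∩ [1, 1+ε) = ∅ for some ε > 0. Then the fixed point set Fix(f) is either empty or consists of exactly one point. -/

import Mathlib

open Topology Filter Metric Set Function

noncomputable section

/-- The plane with the Euclidean norm. -/
abbrev Plane : Type := EuclideanSpace ℝ (Fin 2)

/-- `z : ℂ` is a complex eigenvalue of the continuous `ℝ`-linear map `L : ℝ² → ℝ²`,
i.e. a root of the characteristic polynomial of its matrix in the standard basis. -/
def IsEigenvalueCLM (L : Plane →L[ℝ] Plane) (z : ℂ) : Prop :=
  (((LinearMap.toMatrix (EuclideanSpace.basisFun (Fin 2) ℝ).toBasis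
      (EuclideanSpace.basisFun (Fin 2) ℝ).toBasis) L.toLinearMap).map
      (algebraMap ℝ ℂ)).charpoly.IsRoot z

/-- `Spec` of a map whose derivative at each point `p` is `Df p`: the set of all complex
eigenvalues of all the derivatives. -/
def spec (Df : Plane → Plane →L[ℝ] Plane) : Set ℂ :=
  {z | ∃ p : Plane, IsEigenvalueCLM (Df p) z}


/-- local homeomorphism on an open set, elementary form -/
structure LH {E F : Type*} [TopologicalSpace E] [TopologicalSpace F] (f : E → F) (O : Set E) :
    Prop where
  isOpen : IsOpen O
  cont : Continuous f
  opn : ∀ U, U ⊆ O → IsOpen U → IsOpen (f '' U)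
  inj : ∀ x ∈ O, ∃ U ∈ 𝓝 x, InjOn f U

/-- `y` is the endpoint of a lift of the path `γ` starting at `x`. -/
def LiftTo {E F : Type*} [TopologicalSpace E] (f : E → F) (O : Set E) (x : E)
    (γ : ℝ → F) (y : E) : Prop :=
  ∃ g : ℝ → E, ContinuousOn g (Icc 0 1) ∧ g 0 = x ∧ g 1 = y ∧
    ∀ s ∈ Icc (0 : ℝ) 1, g s ∈ O ∧ f (g s) = γ s

section lifts
variable {E F : Type*} [TopologicalSpace E] [TopologicalSpace F] {f : E → F} {O : Set E}

theorem inj_inverse [Nonempty E] {N : Set E} (hopn : ∀ U, U ⊆ N → IsOpen U → IsOpen (f '' U))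
    (hN : IsOpen N) (hinj : InjOn f N) :
    ∃ J : F → E, ContinuousOn J (f '' N) ∧ (∀ w ∈ f '' N, J w ∈ N ∧ f (J w) = w) ∧
      ∀ u ∈ N, J (f u) = u := by
  have h3 : ∀ u ∈ N, invFunOn f N (f u) = u := fun u hu => hinj.leftInvOn_invFunOn hu
  refine ⟨invFunOn f N, ?_, ?_, h3⟩
  · rintro _ ⟨x, hx, rfl⟩
    refine ContinuousAt.continuousWithinAt ?_
    rw [ContinuousAt, h3 x hx]
    intro W hW
    obtain ⟨W', hW', hWo, hxW⟩ := mem_nhds_iff.1 hW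
    have : f '' (W' ∩ N) ∈ 𝓝 (f x) :=
      (hopn _ inter_subset_right (hWo.inter hN)).mem_nhds ⟨x, ⟨hxW, hx⟩, rfl⟩
    rw [Filter.mem_map]
    refine mem_of_superset this ?_
    rintro _ ⟨y, ⟨hy, hyN⟩, rfl⟩
    simp only [mem_preimage, h3 y hyN]
    exact hW' hy
  · rintro _ ⟨x, hx, rfl⟩
    rw [h3 x hx]; exact ⟨hx, rfl⟩

theorem LH.inverse [Nonempty E] (h : LH f O) {x : E} (hx : x ∈ O) {W : Set E} (hW : W ∈ 𝓝 x) :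
    ∃ U : Set E, IsOpen U ∧ x ∈ U ∧ U ⊆ O ∧ U ⊆ W ∧ IsOpen (f '' U) ∧
    ∃ J : F → E, ContinuousOn J (f '' U) ∧ (∀ w ∈ f '' U, J w ∈ U ∧ f (J w) = w) ∧
      ∀ u ∈ U, J (f u) = u := by
  obtain ⟨V, hV, hi⟩ := h.inj x hx
  have : V ∩ W ∩ O ∈ 𝓝 x := inter_mem (inter_mem hV hW) (h.isOpen.mem_nhds hx)
  obtain ⟨U, hU, hUo, hxU⟩ := mem_nhds_iff.1 this
  have hUO : U ⊆ O := fun y hy => (hU hy).2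
  exact ⟨U, hUo, hxU, hUO, fun y hy => (hU hy).1.2, h.opn U hUO hUo,
    inj_inverse (fun V hV => h.opn V (hV.trans hUO)) hUo (hi.mono fun y hy => (hU hy).1.1)⟩

/-- uniqueness -/
theorem LH.unique [T2Space E] {A : Type*} [TopologicalSpace A] (h : LH f O) {S : Set A}
    (hS : IsPreconnected S) {g1 g2 : A → E} (c1 : ContinuousOn g1 S) (c2 : ContinuousOn g2 S)
    (m1 : ∀ a ∈ S, g1 a ∈ O) (m2 : ∀ a ∈ S, g2 a ∈ O)
    (he : ∀ a ∈ S, f (g1 a) = f (g2 a)) {a0 : A} (ha0 : a0 ∈ S) (h0 : g1 a0 = g2 a0) :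
    ∀ a ∈ S, g1 a = g2 a := by
  have hli : IsLocallyInjective (fun x : O => f x) := by
    rintro ⟨x, hx⟩
    obtain ⟨U, hU, hi⟩ := h.inj x hx
    obtain ⟨U', hU', ho, hxU⟩ := mem_nhds_iff.1 hU
    refine ⟨Subtype.val ⁻¹' U', ho.preimage continuous_subtype_val, hxU, ?_⟩
    intro a ha b hb hab
    exact Subtype.ext (hi (hU' ha) (hU' hb) hab)
  have hsep : IsSeparatedMap (fun x : O => f x) := T2Space.isSeparatedMap _
  have : PreconnectedSpace S := isPreconnected_iff_preconnectedSpace.1 hS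
  have k1 : Continuous (fun a : S => (⟨g1 a, m1 a a.2⟩ : O)) :=
    (continuousOn_iff_continuous_domRestrict.1 c1).subtype_mk _
  have k2 : Continuous (fun a : S => (⟨g2 a, m2 a a.2⟩ : O)) :=
    (continuousOn_iff_continuous_domRestrict.1 c2).subtype_mk _
  have := hsep.eq_of_comp_eq hli k1 k2 (by funext a; exact he a a.2) ⟨a0, ha0⟩
    (Subtype.ext h0)
  intro a ha
  exact congrArg Subtype.val (congrFun this ⟨a, ha⟩)

theorem LH.lift_unique [T2Space E] (h : LH f O) {x y y' : E} {γ : ℝ → F}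
    (h1 : LiftTo f O x γ y) (h2 : LiftTo f O x γ y') : y = y' := by
  obtain ⟨g, c, e0, e1, m⟩ := h1
  obtain ⟨g', c', e0', e1', m'⟩ := h2
  rw [← e1, ← e1']
  exact h.unique isPreconnected_Icc c c' (fun a ha => (m a ha).1) (fun a ha => (m' a ha).1)
    (fun a ha => (m a ha).2.trans (m' a ha).2.symm) (left_mem_Icc.2 zero_le_one)
    (e0.trans e0'.symm) 1 (right_mem_Icc.2 zero_le_one)

theorem LH.tube_aux [T2Space E] [T2Space F] {B : Type*} [TopologicalSpace B] (h : LH f O)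
    {σ : B → E} {γ : B → ℝ → F} (hσ : Continuous σ) (hγ : Continuous (uncurry γ))
    (h0 : ∀ b, f (σ b) = γ b 0) {b0 : B} {y0 : E} (hl : LiftTo f O (σ b0) (γ b0) y0)
    {W : Set E} (hW : W ∈ 𝓝 y0) :
    ∀ᶠ b in 𝓝 b0, ∃ y ∈ W, LiftTo f O (σ b) (γ b) y := by
  obtain ⟨g, c, e0, e1, m⟩ := hl
  have : Nonempty E := ⟨y0⟩
  set Θ : E × ℝ → F × ℝ := fun p => (f p.1, p.2) with hΘ
  have hΘc : Continuous Θ := (h.cont.comp continuous_fst).prodMk continuous_snd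
  set K : Set (E × ℝ) := (fun s => (g s, s)) '' Icc 0 1 with hK
  have hKc : IsCompact K := isCompact_Icc.image_of_continuousOn (c.prodMk continuousOn_id)
  have hinj : InjOn Θ K := by
    rintro _ ⟨s, hs, rfl⟩ _ ⟨t, ht, rfl⟩ hst
    have : s = t := congrArg Prod.snd hst
    rw [this]
  have hloc : ∀ p ∈ K, ∃ u ∈ 𝓝 p, InjOn Θ u := by
    rintro _ ⟨s, hs, rfl⟩
    obtain ⟨U, hU, hi⟩ := h.inj (g s) (m s hs).1
    refine ⟨U ×ˢ univ, prod_mem_nhds hU univ_mem, ?_⟩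
    rintro ⟨a, r⟩ ha ⟨b, q⟩ hb hab
    have h1 : f a = f b := congrArg Prod.fst hab
    have h2 : r = q := congrArg Prod.snd hab
    exact Prod.ext (hi ha.1 hb.1 h1) h2
  obtain ⟨N0, hN0, hKN0, hi0⟩ := hinj.exists_isOpen_superset hKc (fun p _ => hΘc.continuousAt) hloc
  set N := N0 ∩ (O ×ˢ univ) with hN
  have hNo : IsOpen N := hN0.inter (h.isOpen.prod isOpen_univ)
  have hKN : K ⊆ N := by
    intro p hp
    refine ⟨hKN0 hp, ?_⟩
    obtain ⟨s, hs, rfl⟩ := hp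
    exact ⟨(m s hs).1, mem_univ _⟩
  have hiN : InjOn Θ N := hi0.mono inter_subset_left
  have hopn : ∀ U, U ⊆ N → IsOpen U → IsOpen (Θ '' U) := by
    intro U hUN hU
    rw [isOpen_iff_mem_nhds]
    rintro _ ⟨⟨x, s⟩, hx, rfl⟩
    obtain ⟨A, A', hA, hA', hxA, hsA, hAA⟩ := isOpen_prod_iff.1 hU x s hx
    have hsub : (f '' (A ∩ O)) ×ˢ A' ⊆ Θ '' U := by
      rintro ⟨w, r⟩ ⟨⟨a, ha, rfl⟩, hr⟩
      exact ⟨(a, r), hAA ⟨ha.1, hr⟩, rfl⟩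
    refine mem_of_superset (prod_mem_nhds ((h.opn (A ∩ O) inter_subset_right
      (hA.inter h.isOpen)).mem_nhds ⟨x, ⟨hxA, (hUN hx).2.1⟩, rfl⟩) (hA'.mem_nhds hsA)) hsub
  obtain ⟨J, Jc, Jm, Ju⟩ := inj_inverse hopn hNo hiN
  -- eventually the graph is inside
  have hev : ∀ᶠ b in 𝓝 b0, ∀ s ∈ Icc (0 : ℝ) 1, (γ b s, s) ∈ Θ '' N := by
    apply isCompact_Icc.eventually_forall_of_forall_eventually
    intro s hs
    have hc : Continuous (fun p : B × ℝ => (γ p.1 p.2, p.2)) := hγ.prodMk continuous_snd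
    refine hc.continuousAt.eventually ((hopn N subset_rfl hNo).mem_nhds ?_)
    exact ⟨(g s, s), hKN ⟨s, hs, rfl⟩, by simp [hΘ, (m s hs).2]⟩
  have hev0 : ∀ᶠ b in 𝓝 b0, (σ b, (0 : ℝ)) ∈ N := by
    refine (hσ.prodMk continuous_const).continuousAt.eventually (hNo.mem_nhds ?_)
    change (σ b0, (0 : ℝ)) ∈ N
    rw [← e0]
    exact hKN ⟨0, left_mem_Icc.2 zero_le_one, rfl⟩
  have hev1 : ∀ᶠ b in 𝓝 b0, (γ b 1, (1 : ℝ)) ∈ Θ '' (N ∩ (interior W ×ˢ univ)) := by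
    have hc : Continuous (fun b : B => (γ b 1, (1 : ℝ))) :=
      (hγ.comp (continuous_id.prodMk continuous_const)).prodMk continuous_const
    refine hc.continuousAt.eventually ((hopn _ inter_subset_left
      (hNo.inter (isOpen_interior.prod isOpen_univ))).mem_nhds ?_)
    have h1 : (1 : ℝ) ∈ Icc (0 : ℝ) 1 := right_mem_Icc.2 zero_le_one
    refine ⟨(g 1, 1), ⟨hKN ⟨1, h1, rfl⟩, ?_, mem_univ _⟩, by simp [hΘ, (m 1 h1).2]⟩
    rw [e1]; exact mem_interior_iff_mem_nhds.2 hW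
  filter_upwards [hev, hev0, hev1] with b hb hb0 hb1
  obtain ⟨⟨y, s⟩, ⟨hyN, hyW⟩, hy⟩ := hb1
  have hJ1 : J (γ b 1, 1) = (y, s) := by rw [← hy]; exact Ju _ hyN
  refine ⟨y, interior_subset hyW.1, fun s => (J (γ b s, s)).1, ?_, ?_, ?_, ?_⟩
  · have : ContinuousOn (fun s : ℝ => (γ b s, s)) (Icc 0 1) := by
      refine Continuous.continuousOn ?_
      exact (hγ.comp (continuous_const.prodMk continuous_id)).prodMk continuous_id
    exact continuous_fst.comp_continuousOn (Jc.comp this hb)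
  · have : (γ b 0, (0 : ℝ)) = Θ (σ b, 0) := by simp [hΘ, h0]
    simp only [this, Ju _ hb0]
  · simp only [hJ1]
  · intro s hs
    have := Jm _ (hb s hs)
    exact ⟨this.1.2.1, congrArg Prod.fst this.2⟩

theorem LH.tube [T2Space E] [T2Space F] [Nonempty E] {B : Type*} [TopologicalSpace B] (h : LH f O)
    {σ : B → E} {γ : B → ℝ → F} (hσ : Continuous σ) (hγ : Continuous (uncurry γ))
    (h0 : ∀ b, f (σ b) = γ b 0) :
    ∃ (Dom : Set B) (Y : B → E), IsOpen Dom ∧ ContinuousOn Y Dom ∧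
      (∀ b ∈ Dom, LiftTo f O (σ b) (γ b) (Y b)) ∧
      ∀ b y, LiftTo f O (σ b) (γ b) y → b ∈ Dom ∧ Y b = y := by
  classical
  set Dom : Set B := {b | ∃ y, LiftTo f O (σ b) (γ b) y}
  set Y : B → E := fun b => if hb : ∃ y, LiftTo f O (σ b) (γ b) y then hb.choose
    else Classical.arbitrary E with hY
  have hYd : ∀ b ∈ Dom, LiftTo f O (σ b) (γ b) (Y b) := by
    intro b hb
    have hb' : ∃ y, LiftTo f O (σ b) (γ b) y := hb
    simp only [hY, dif_pos hb']
    exact hb'.choose_spec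
  refine ⟨Dom, Y, ?_, ?_, hYd, fun b y hl => ⟨⟨y, hl⟩, h.lift_unique (hYd b ⟨y, hl⟩) hl⟩⟩
  · rw [isOpen_iff_eventually]
    rintro b ⟨y, hl⟩
    filter_upwards [h.tube_aux hσ hγ h0 hl univ_mem] with b' hb'
    obtain ⟨y, _, hy⟩ := hb'
    exact ⟨y, hy⟩
  · intro b hb
    refine ContinuousAt.continuousWithinAt ?_
    intro W hW
    rw [Filter.mem_map]
    filter_upwards [h.tube_aux hσ hγ h0 (hYd b hb) hW] with b' hb'
    obtain ⟨y, hyW, hy⟩ := hb'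
    rw [mem_preimage, h.lift_unique (hYd b' ⟨y, hy⟩) hy]
    exact hyW

theorem LiftTo.initial {x y : E} {A : ℝ → F} {v v' : ℝ} (h0 : 0 ≤ v') (hv : v' ≤ v)
    (h : LiftTo f O x (fun s => A (s * v)) y) : ∃ y', LiftTo f O x (fun s => A (s * v')) y' := by
  obtain ⟨g, c, e0, e1, m⟩ := h
  rcases eq_or_lt_of_le (h0.trans hv) with hz | hp
  · have : v' = v := by linarith
    subst this
    exact ⟨y, g, c, e0, e1, m⟩
  · have hr : ∀ s ∈ Icc (0 : ℝ) 1, s * (v' / v) ∈ Icc (0 : ℝ) 1 := by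
      intro s hs
      have h1 : 0 ≤ v' / v := by positivity
      have h2 : v' / v ≤ 1 := (div_le_one hp).2 hv
      exact ⟨mul_nonneg hs.1 h1, mul_le_one₀ hs.2 h1 h2⟩
    refine ⟨_, fun s => g (s * (v' / v)), ?_, by simpa using e0, rfl, ?_⟩
    · exact c.comp (by fun_prop) hr
    · intro s hs
      refine ⟨(m _ (hr s hs)).1, ?_⟩
      rw [(m _ (hr s hs)).2]
      field_simp

theorem LiftTo.glue {x y : E} {A : ℝ → F} {v1 v2 : ℝ} (h0 : 0 < v1) (hv : v1 ≤ v2)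
    (h : LiftTo f O x (fun s => A (s * v1)) y) {k : ℝ → E} (hk : ContinuousOn k (Icc v1 v2))
    (hk1 : k v1 = y) (hm : ∀ v ∈ Icc v1 v2, k v ∈ O ∧ f (k v) = A v) :
    LiftTo f O x (fun s => A (s * v2)) (k v2) := by
  have hp : 0 < v2 := h0.trans_le hv
  obtain ⟨g, c, e0, e1, m⟩ := h
  set G : ℝ → E := fun v => if v ≤ v1 then g (v / v1) else k v with hG
  have G1 : ∀ v, v ≤ v1 → G v = g (v / v1) := fun v h => by simp [hG, h]
  have G2 : ∀ v, v1 ≤ v → G v = k v := by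
    intro v h
    rcases eq_or_lt_of_le h with rfl | h
    · rw [G1 _ le_rfl, div_self h0.ne', e1, hk1]
    · simp [hG, not_le.2 h]
  have hr : ∀ v ∈ Icc 0 v1, v / v1 ∈ Icc (0 : ℝ) 1 := fun v hv =>
    ⟨div_nonneg hv.1 h0.le, (div_le_one h0).2 hv.2⟩
  have c1 : ContinuousOn G (Icc 0 v1) := by
    have : ContinuousOn (fun v => g (v / v1)) (Icc 0 v1) := c.comp (by fun_prop) hr
    exact this.congr fun v hv => G1 v hv.2
  have c2 : ContinuousOn G (Icc v1 v2) := hk.congr fun v hv => G2 v hv.1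
  have c3 : ContinuousOn G (Icc 0 v2) := by
    rw [← Icc_union_Icc_eq_Icc h0.le hv]
    exact c1.union_of_isClosed c2 isClosed_Icc isClosed_Icc
  have hr2 : ∀ s ∈ Icc (0 : ℝ) 1, s * v2 ∈ Icc 0 v2 := fun s hs =>
    ⟨mul_nonneg hs.1 hp.le, mul_le_of_le_one_left hp.le hs.2⟩
  refine ⟨fun s => G (s * v2), c3.comp (by fun_prop) hr2, ?_, ?_, ?_⟩
  · simp only [zero_mul]
    rw [G1 0 h0.le, zero_div, e0]
  · simp only [one_mul]; exact G2 _ hv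
  · intro s hs
    have h2 := hr2 s hs
    rcases le_total (s * v2) v1 with h | h
    · simp only [G1 _ h]
      have := m _ (hr _ ⟨h2.1, h⟩)
      simp only [div_mul_cancel₀ _ h0.ne'] at this
      exact this
    · simp only [G2 _ h]
      exact hm _ ⟨h, h2.2⟩

/-- extension past a limit -/
theorem LH.extend [T2Space E] [T2Space F] (h : LH f O) {x : E} {A : ℝ → F} (hA : Continuous A)
    {vs : ℝ} (hvs : 0 < vs) {C : Set E} (hC : IsCompact C)
    (hCO : ∀ y ∈ C, f y = A vs → y ∈ O)
    (hf : ∃ᶠ v in 𝓝[<] vs, ∃ y ∈ C, LiftTo f O x (fun s => A (s * v)) y) :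
    ∃ y, LiftTo f O x (fun s => A (s * vs)) y := by
  have : Nonempty E := ⟨x⟩
  choose! Y hYC hY using (fun v (hv : ∃ y ∈ C, LiftTo f O x (fun s => A (s * v)) y) => hv)
  set G : Set ℝ := {v | ∃ y ∈ C, LiftTo f O x (fun s => A (s * v)) y}
  set l : Filter ℝ := 𝓝[<] vs ⊓ 𝓟 G
  have hl : l.NeBot := frequently_mem_iff_neBot.1 hf
  have hlG : ∀ᶠ v in l, v ∈ G := mem_inf_of_right (mem_principal_self G)
  have hmap : map Y l ≤ 𝓟 C := by
    rw [le_principal_iff, Filter.mem_map]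
    filter_upwards [hlG] with v hv using hYC v hv
  obtain ⟨y, hyC, hcl⟩ := hC.exists_clusterPt hmap
  have hfeq : ∀ v ∈ G, f (Y v) = A v := by
    intro v hv
    obtain ⟨g, c, e0, e1, m⟩ := hY v hv
    have := (m 1 (right_mem_Icc.2 zero_le_one)).2
    simpa only [e1, one_mul] using this
  have hlv : Tendsto id l (𝓝 vs) := tendsto_id.mono_left (inf_le_left.trans nhdsWithin_le_nhds)
  have hfy : f y = A vs := by
    have h1 : MapClusterPt (f y) l (fun v => f (Y v)) :=
      MapClusterPt.continuousAt_comp h.cont.continuousAt hcl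
    have h2 : Tendsto (fun v => f (Y v)) l (𝓝 (A vs)) := by
      refine (hA.continuousAt.tendsto.comp hlv).congr' ?_
      filter_upwards [hlG] with v hv using (hfeq v hv).symm
    have h3 : ClusterPt (f y) (map (fun v => f (Y v)) l) := h1
    exact eq_of_nhds_neBot (h3.neBot.mono (inf_le_inf_left _ h2))
  have hyO : y ∈ O := hCO y hyC hfy
  obtain ⟨U, hUo, hyU, hUO, -, hfU, J, Jc, Jm, Ju⟩ := h.inverse hyO univ_mem
  have hnA : ∀ᶠ v in 𝓝 vs, A v ∈ f '' U :=
    hA.continuousAt.eventually (hfU.mem_nhds ⟨y, hyU, hfy⟩)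
  obtain ⟨δ, hδ, hball⟩ := Metric.eventually_nhds_iff.1 hnA
  have hfr : ∃ᶠ v in l, Y v ∈ U := hcl.frequently (hUo.mem_nhds hyU)
  have hev : ∀ᶠ v in l, v ∈ G ∧ v < vs ∧ 0 < v ∧ dist v vs < δ := by
    refine hlG.and ?_
    have h1 : ∀ᶠ v in l, v < vs := mem_inf_of_left self_mem_nhdsWithin
    have h2 : ∀ᶠ v in l, 0 < v := hlv.eventually (lt_mem_nhds hvs)
    have h3 : ∀ᶠ v in l, dist v vs < δ := hlv.eventually (Metric.ball_mem_nhds vs hδ)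
    exact h1.and (h2.and h3)
  obtain ⟨v, hvU, hvG, hvs', hv0, hvd⟩ := (hfr.and_eventually hev).exists
  have hin : ∀ r ∈ Icc v vs, A r ∈ f '' U := by
    intro r hr
    apply hball
    rw [Real.dist_eq, abs_lt] at *
    constructor <;> linarith [hr.1, hr.2]
  refine ⟨_, (hY v hvG).glue hv0 hvs'.le (k := fun r => J (A r)) (Jc.comp hA.continuousOn hin) ?_ ?_⟩
  · simp only [← hfeq v hvG, Ju _ hvU]
  · intro r hr
    exact ⟨hUO (Jm _ (hin r hr)).1, (Jm _ (hin r hr)).2⟩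

/-- continuation -/
theorem LH.continuation [T2Space E] [T2Space F] (h : LH f O) {x : E} {A : ℝ → F}
    (hA : Continuous A) (hx : x ∈ O) (hx0 : f x = A 0) {V : ℝ}
    {C : Set E} (hC : IsCompact C)
    (hCO : ∀ v ∈ Icc 0 V, ∀ y ∈ C, f y = A v → y ∈ O) (hOC : O ⊆ C) :
    ∀ v ∈ Icc 0 V, ∃ y, LiftTo f O x (fun s => A (s * v)) y := by
  have : Nonempty E := ⟨x⟩
  obtain ⟨Dom, Y, hD, hY, hl, hu⟩ := h.tube (B := ℝ) (σ := fun _ => x)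
    (γ := fun v s => A (s * v)) continuous_const (by unfold uncurry; fun_prop) (by simp [hx0])
  suffices ∀ v ∈ Icc 0 V, v ∈ Dom from fun v hv => ⟨_, hl v (this v hv)⟩
  by_contra hcon
  push Not at hcon
  obtain ⟨v0, hv0, hn⟩ := hcon
  have hcomp : IsCompact (Icc 0 V ∩ Domᶜ) := isCompact_Icc.inter_right hD.isClosed_compl
  obtain ⟨vs, ⟨hvs, hvsD⟩, hmin⟩ := hcomp.exists_isLeast ⟨v0, hv0, hn⟩
  have h0D : (0 : ℝ) ∈ Dom := by
    refine (hu 0 x ⟨fun _ => x, continuousOn_const, rfl, rfl, fun s _ => ⟨hx, ?_⟩⟩).1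
    simp [hx0]
  have hpos : 0 < vs := by
    rcases eq_or_lt_of_le hvs.1 with h | h
    · exact absurd (h ▸ h0D) hvsD
    · exact h
  have hD' : ∀ v ∈ Ico 0 vs, v ∈ Dom := by
    intro v hv
    by_contra hv'
    exact absurd (hmin ⟨⟨hv.1, hv.2.le.trans hvs.2⟩, hv'⟩) (not_le.2 hv.2)
  have := h.extend hA hpos hC (hCO vs hvs) (x := x) ?_
  · obtain ⟨y, hy⟩ := this
    exact hvsD (hu vs y hy).1
  · refine Eventually.frequently ?_
    filter_upwards [Ioo_mem_nhdsLT hpos] with v hv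
    have hlv := hl v (hD' v ⟨hv.1.le, hv.2⟩)
    refine ⟨_, ?_, hlv⟩
    obtain ⟨g, c, e0, e1, m⟩ := hlv
    rw [← e1]
    exact hOC (m 1 (right_mem_Icc.2 zero_le_one)).1
end lifts


section minlemma
variable {E F : Type*} [NormedAddCommGroup E] [NormedSpace ℝ E] [FiniteDimensional ℝ E]

theorem min_lemma [NormedAddCommGroup F] [InnerProductSpace ℝ F] {f : E → F} {f' : E → E →L[ℝ] F}
    {p : E} {r : ℝ} (hr : 0 < r) (hd : ∀ y ∈ closedBall p r, HasFDerivAt f (f' y) y)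
    (hs : ∀ y ∈ ball p r, Surjective (f' y)) {w : F}
    (hw : ∀ y ∈ sphere p r, ‖f p - w‖ < ‖f y - w‖) : ∃ y ∈ ball p r, f y = w := by
  have : ProperSpace E := FiniteDimensional.proper ℝ E
  have hc : ContinuousOn (fun y => ‖f y - w‖ ^ 2) (closedBall p r) := by
    have : ContinuousOn f (closedBall p r) := fun y hy => (hd y hy).continuousAt.continuousWithinAt
    fun_prop
  obtain ⟨y, hy, hmin⟩ := (isCompact_closedBall p r).exists_isMinOn
    ⟨p, mem_closedBall_self hr.le⟩ hc
  have hyb : y ∈ ball p r := by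
    rw [← sphere_union_ball] at hy
    rcases hy with hy | hy
    · have h1 := hw y hy
      have h2 : ‖f y - w‖ ^ 2 ≤ ‖f p - w‖ ^ 2 := hmin (mem_closedBall_self hr.le)
      have := pow_lt_pow_left₀ h1 (norm_nonneg _) two_ne_zero
      linarith
    · exact hy
  refine ⟨y, hyb, ?_⟩
  have hloc : IsLocalMin (fun y => ‖f y - w‖ ^ 2) y :=
    hmin.isLocalMin (mem_of_superset (isOpen_ball.mem_nhds hyb) ball_subset_closedBall)
  have hder := ((hd y hy).sub_const w).norm_sq
  have h0 := hloc.hasFDerivAt_eq_zero hder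
  obtain ⟨v, hv⟩ := hs y hyb (f y - w)
  have := congrArg (fun L => L v) h0
  have h2 : inner ℝ (f y - w) (f y - w) = 0 := by
    simp only [ContinuousLinearMap.zero_apply, ContinuousLinearMap.smul_apply,
      ContinuousLinearMap.comp_apply, hv, innerSL_apply_apply] at this
    simpa only [nsmul_eq_mul, Nat.cast_ofNat, mul_eq_zero, OfNat.ofNat_ne_zero, false_or] using this
  exact sub_eq_zero.1 (inner_self_eq_zero.1 h2)

/-- quantitative injectivity -/
theorem quant_inj [NormedAddCommGroup F] [NormedSpace ℝ F] {f : E → F} {f' : E →L[ℝ] F} {x : E}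
    (hd : HasFDerivAt f f' x) (hi : Injective f') :
    ∃ k : ℕ, ∀ y, ‖y - x‖ < 1 / ((k : ℝ) + 1) → ‖y - x‖ ≤ ((k : ℝ) + 1) * ‖f y - f x‖ := by
  obtain ⟨C, hC, hanti⟩ := f'.toLinearMap.exists_antilipschitzWith (LinearMap.ker_eq_bot.2 hi)
  have hC' : ∀ v, ‖v‖ ≤ C * ‖f' v‖ := fun v => by
    simpa using hanti.le_mul_dist v 0
  have hCp : (0 : ℝ) < C := by exact_mod_cast hC
  have ho := hd.isLittleO
  have := ho.def (c := 1 / (2 * C)) (by positivity)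
  obtain ⟨δ, hδ, hb⟩ := Metric.eventually_nhds_iff.1 this
  obtain ⟨k, hk⟩ := exists_nat_gt (max (1 / δ) (2 * C))
  have hk1 : 1 / δ < k := (le_max_left _ _).trans_lt hk
  have hk2 : 2 * (C : ℝ) < k := (le_max_right _ _).trans_lt hk
  refine ⟨k, fun y hy => ?_⟩
  have hyδ : dist y x < δ := by
    rw [dist_eq_norm]
    refine hy.trans ?_
    rw [div_lt_iff₀ hδ] at hk1
    rw [div_lt_iff₀ (by positivity)]
    nlinarith
  have h1 := hb hyδ
  have h2 := hC' (y - x)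
  have h3 : ‖f' (y - x)‖ ≤ ‖f y - f x‖ + 1 / (2 * C) * ‖y - x‖ := by
    have : f' (y - x) = (f y - f x) - (f y - f x - f' (y - x)) := by abel
    calc ‖f' (y - x)‖ = ‖(f y - f x) - (f y - f x - f' (y - x))‖ := by rw [← this]
      _ ≤ _ := (norm_sub_le _ _).trans (by linarith)
  have h4 : ‖y - x‖ ≤ C * ‖f y - f x‖ + 1 / 2 * ‖y - x‖ := by
    calc ‖y - x‖ ≤ C * (‖f y - f x‖ + 1 / (2 * C) * ‖y - x‖) :=
          h2.trans (mul_le_mul_of_nonneg_left h3 hCp.le)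
      _ = _ := by field_simp
  nlinarith [norm_nonneg (f y - f x)]

theorem open_of_inj {f : E → E} {f' : E → E →L[ℝ] E} {U : Set E} (hU : IsOpen U)
    (hd : ∀ y, HasFDerivAt f (f' y) y) (hi : ∀ y ∈ U, Injective (f' y)) : IsOpen (f '' U) := by
  set T := toEuclidean (E := E)
  have hTd : ∀ y, HasFDerivAt (fun y => T (f y)) ((T : E →L[ℝ] _).comp (f' y)) y :=
    fun y => HasFDerivAt.comp y (T.hasFDerivAt (x := f y)) (hd y)
  suffices h : IsOpen ((fun y => T (f y)) '' U) by
    have h2 := h.preimage T.continuous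
    convert h2 using 1
    ext w
    constructor
    · rintro ⟨u, hu, rfl⟩; exact ⟨u, hu, rfl⟩
    · rintro ⟨u, hu, h⟩; exact ⟨u, hu, T.injective h⟩
  rw [isOpen_iff_mem_nhds]
  rintro _ ⟨x, hx, rfl⟩
  obtain ⟨k, hk⟩ := quant_inj (hTd x) (T.injective.comp (hi x hx))
  have hkp : (0 : ℝ) < k + 1 := by positivity
  obtain ⟨r0, hr0, hr0U⟩ := Metric.isOpen_iff.1 hU x hx
  set r := min (r0 / 2) (1 / ((k : ℝ) + 1) / 2) with hrdef
  have hr : 0 < r := by positivity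
  have hrr0 : r < r0 := (min_le_left _ _).trans_lt (by linarith)
  have hrk : r < 1 / ((k : ℝ) + 1) := (min_le_right _ _).trans_lt (half_lt_self (by positivity))
  rw [Metric.mem_nhds_iff]
  refine ⟨r / (k + 1) / 2, by positivity, fun w hw => ?_⟩
  rw [mem_ball, dist_comm, dist_eq_norm] at hw
  obtain ⟨y, hy, hyw⟩ := min_lemma (f := fun y => T (f y)) (w := w) hr (fun y _ => hTd y) (by
      intro y hy
      refine T.surjective.comp ?_
      exact LinearMap.surjective_of_injective (f := (f' y).toLinearMap)
        (hi y (hr0U (ball_subset_ball hrr0.le hy)))) (by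
      intro y hy
      have hyr : ‖y - x‖ = r := by simpa [dist_eq_norm] using hy
      have h1 := hk y (by rw [hyr]; exact hrk)
      rw [hyr] at h1
      have h2 : r / (k + 1) ≤ ‖T (f y) - T (f x)‖ := by rw [div_le_iff₀ hkp]; linarith
      have h3 : ‖T (f y) - T (f x)‖ ≤ ‖T (f y) - w‖ + ‖T (f x) - w‖ := by
        have : T (f y) - T (f x) = (T (f y) - w) - (T (f x) - w) := by abel
        rw [this]; exact norm_sub_le _ _
      linarith)
  exact ⟨y, hr0U (ball_subset_ball hrr0.le hy), hyw⟩
end minlemma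


section locinj
variable {E : Type*} [NormedAddCommGroup E] [NormedSpace ℝ E] [FiniteDimensional ℝ E]

/-- Baire step -/
theorem baire_step {f : E → E} {f' : E → E →L[ℝ] E} {O B : Set E} (hO : IsOpen O)
    (hd : ∀ y, HasFDerivAt f (f' y) y) (hi : ∀ y ∈ O, Injective (f' y)) (hBO : B ⊆ O)
    (hOB : IsOpen (O \ B)) {x : E} (hx : x ∈ B) :
    ∃ x0 ∈ B, ∃ K r0 : ℝ, 0 < K ∧ 0 < r0 ∧ ball x0 r0 ⊆ O ∧
      ∀ b ∈ B ∩ ball x0 r0, ∀ y ∈ ball x0 r0, ‖y - b‖ ≤ K * ‖f y - f b‖ := by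
  have hprop : ProperSpace E := FiniteDimensional.proper ℝ E
  have hfc : Continuous f := continuous_iff_continuousAt.2 fun y => (hd y).continuousAt
  obtain ⟨ρ0, hρ0, hρO⟩ := Metric.isOpen_iff.1 hO x (hBO hx)
  set ρ := ρ0 / 2
  have hρ : 0 < ρ := by positivity
  have hcO : closedBall x ρ ⊆ O := (closedBall_subset_ball (by simp [ρ, hρ0])).trans hρO
  set B' : Set E := closure (B ∩ ball x ρ)
  have hB'B : B' ⊆ B := by
    intro y hy
    have h1 : y ∈ closedBall x ρ :=
      closure_minimal (inter_subset_right.trans ball_subset_closedBall) isClosed_closedBall hy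
    have h2 : y ∈ (O \ B)ᶜ :=
      closure_minimal (fun z hz hz2 => hz2.2 hz.1) hOB.isClosed_compl hy
    by_contra h3
    exact h2 ⟨hcO h1, h3⟩
  have hcl : IsClosed B' := isClosed_closure
  have : CompleteSpace B' := hcl.completeSpace_coe
  have : Nonempty B' := ⟨⟨x, subset_closure ⟨hx, mem_ball_self hρ⟩⟩⟩
  set Ek : ℕ → Set E := fun k => {b | ∀ y, ‖y - b‖ < 1 / ((k : ℝ) + 1) →
    ‖y - b‖ ≤ ((k : ℝ) + 1) * ‖f y - f b‖} with hEk
  have hEc : ∀ k, IsClosed (Ek k) := by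
    intro k
    have : Ek k = ⋂ y, ({b | 1 / ((k : ℝ) + 1) ≤ ‖y - b‖} ∪
        {b | ‖y - b‖ ≤ ((k : ℝ) + 1) * ‖f y - f b‖}) := by
      ext b
      simp only [hEk, mem_ofPred_eq, mem_iInter, mem_union]
      refine forall_congr' fun y => ?_
      rw [imp_iff_not_or, not_lt]
    rw [this]
    refine isClosed_iInter fun y => ?_
    exact (isClosed_le (by fun_prop) (by fun_prop)).union (isClosed_le (by fun_prop) (by fun_prop))
  obtain ⟨k, b1, hb1⟩ := nonempty_interior_of_iUnion_of_closed
    (f := fun k => (Subtype.val ⁻¹' Ek k : Set B'))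
    (fun k => (hEc k).preimage continuous_subtype_val) (by
      rw [eq_univ_iff_forall]
      rintro ⟨b, hb⟩
      obtain ⟨k, hk⟩ := quant_inj (hd b) (hi b (hBO (hB'B hb)))
      exact mem_iUnion.2 ⟨k, hk⟩)
  obtain ⟨W', hW', hW'o, hbW'⟩ := mem_interior.1 hb1
  obtain ⟨W, hW, rfl⟩ := isOpen_induced_iff.1 hW'o
  obtain ⟨x0, hx0W, hx0B, hx0b⟩ := mem_closure_iff.1 b1.2 W hW hbW'
  obtain ⟨r1, hr1, hr1W⟩ := Metric.isOpen_iff.1 (hW.inter isOpen_ball) x0 ⟨hx0W, hx0b⟩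
  have hkp : (0 : ℝ) < k + 1 := by positivity
  refine ⟨x0, hx0B, k + 1, min r1 (1 / ((k : ℝ) + 1) / 2), hkp, by positivity, ?_, ?_⟩
  · intro y hy
    exact hcO (ball_subset_closedBall (hr1W (ball_subset_ball (min_le_left _ _) hy)).2)
  · rintro b ⟨hbB, hbb⟩ y hy
    have h1 := hr1W (ball_subset_ball (min_le_left _ _) hbb)
    have hbB' : b ∈ B' := subset_closure ⟨hbB, h1.2⟩
    have h2 : b ∈ Ek k := hW' (show (⟨b, hbB'⟩ : B') ∈ Subtype.val ⁻¹' W from h1.1)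
    refine h2 y ?_
    have h3 := ball_subset_ball (min_le_right _ _) hbb
    have h4 := ball_subset_ball (min_le_right _ _) hy
    rw [mem_ball] at h3 h4
    rw [← dist_eq_norm]
    have := dist_triangle_right y b x0
    linarith

theorem loc_inj {f : E → E} {f' : E → E →L[ℝ] E} {O : Set E} (hO : IsOpen O)
    (hd : ∀ y, HasFDerivAt f (f' y) y) (hi : ∀ y ∈ O, Injective (f' y)) :
    ∀ x ∈ O, ∃ U ∈ 𝓝 x, InjOn f U := by
  have hprop : ProperSpace E := FiniteDimensional.proper ℝ E
  have hfc : Continuous f := continuous_iff_continuousAt.2 fun y => (hd y).continuousAt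
  set B : Set E := {x ∈ O | ¬ ∃ U ∈ 𝓝 x, InjOn f U} with hB
  have hBO : B ⊆ O := fun x hx => hx.1
  have hOB : IsOpen (O \ B) := by
    rw [isOpen_iff_mem_nhds]
    rintro x ⟨hxO, hxB⟩
    have : ∃ U ∈ 𝓝 x, InjOn f U := by
      by_contra h; exact hxB ⟨hxO, h⟩
    obtain ⟨U, hU, hinj⟩ := this
    filter_upwards [hO.mem_nhds hxO, eventually_mem_nhds_iff.2 hU] with y hy1 hy2
    exact ⟨hy1, fun h => h.2 ⟨U, hy2, hinj⟩⟩
  by_contra hcon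
  push Not at hcon
  obtain ⟨x, hxO, hx⟩ := hcon
  obtain ⟨x0, hx0, K, r0, hK, hr0, hbO, hq⟩ := baire_step hO hd hi hBO hOB (x := x)
    ⟨hxO, fun ⟨U, h1, h2⟩ => hx U h1 h2⟩
  set r := r0 / 2 with hr_def
  have hr : 0 < r := by positivity
  have hcb : closedBall x0 r ⊆ ball x0 r0 := closedBall_subset_ball (by linarith)
  have hbb : ball x0 r ⊆ ball x0 r0 := ball_subset_closedBall.trans hcb
  have hx0r : x0 ∈ ball x0 r0 := mem_ball_self hr0
  set m := r / (4 * K) with hm_def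
  have hm : 0 < m := by positivity
  have hKm : K * m = r / 4 := by rw [hm_def]; field_simp
  set O' := ball x0 r \ B with hO'
  have hO'O : O' ⊆ O := fun y hy => hbO (hbb hy.1)
  have hO'eq : O' = ball x0 r ∩ (O \ B) := by
    ext y; exact ⟨fun h => ⟨h.1, hO'O h, h.2⟩, fun h => ⟨h.1, h.2.2⟩⟩
  have hlh : LH f O' := by
    refine ⟨by rw [hO'eq]; exact isOpen_ball.inter hOB, hfc, ?_, ?_⟩
    · intro U hU hUo
      exact open_of_inj hUo hd fun y hy => hi y (hO'O (hU hy))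
    · intro y hy
      by_contra h
      exact hy.2 ⟨hO'O hy, h⟩
  -- the double point
  have hdbl : ∃ y1 y2, y1 ∈ O' ∧ y2 ∈ O' ∧ y1 ≠ y2 ∧ f y1 = f y2 ∧ ‖f y1 - f x0‖ < m := by
    have hU : {y | y ∈ ball x0 r ∧ dist (f y) (f x0) < m} ∈ 𝓝 x0 :=
      inter_mem (ball_mem_nhds x0 hr) (hfc.continuousAt.eventually (ball_mem_nhds _ hm))
    have hni : ¬ InjOn f {y | y ∈ ball x0 r ∧ dist (f y) (f x0) < m} := fun h => hx0.2 ⟨_, hU, h⟩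
    simp only [InjOn, not_forall] at hni
    obtain ⟨y1, h1, y2, h2, he, hne⟩ := hni
    have hno : ∀ a b, a ∈ ball x0 r → b ∈ ball x0 r → f a = f b → a ≠ b → a ∉ B := by
      intro a b ha hb hab hne haB
      have := hq a ⟨haB, hbb ha⟩ b (hbb hb)
      rw [hab, sub_self, norm_zero, mul_zero] at this
      exact hne (sub_eq_zero.1 (norm_le_zero_iff.1 this)).symm
    exact ⟨y1, y2, ⟨h1.1, hno y1 y2 h1.1 h2.1 he hne⟩,
      ⟨h2.1, hno y2 y1 h2.1 h1.1 he.symm (Ne.symm hne)⟩, hne, he, by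
        rw [← dist_eq_norm]; exact h1.2⟩
  obtain ⟨y1, y2, hy1, hy2, hne, hfe, hfm⟩ := hdbl
  obtain ⟨w, hw⟩ : ∃ w, w = f y1 := ⟨_, rfl⟩
  set KK := f '' (B ∩ closedBall x0 r) with hKK
  have hKKc : IsCompact KK := by
    refine IsCompact.image ?_ hfc
    have : B ∩ closedBall x0 r = closedBall x0 r ∩ (O \ B)ᶜ := by
      ext y
      constructor
      · exact fun h => ⟨h.2, fun h2 => h2.2 h.1⟩
      · rintro ⟨h, h2⟩
        refine ⟨?_, h⟩
        by_contra h3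
        exact h2 ⟨hbO (hcb h), h3⟩
    rw [this]
    exact (isCompact_closedBall _ _).inter_right hOB.isClosed_compl
  have hx0KK : f x0 ∈ KK := ⟨x0, ⟨hx0, mem_closedBall_self hr.le⟩, rfl⟩
  obtain ⟨_, ⟨z1, ⟨hz1B, hz1b⟩, rfl⟩, hz1⟩ := hKKc.exists_infDist_eq_dist ⟨_, hx0KK⟩ w
  obtain ⟨d, hd_def⟩ : ∃ d, d = dist w (f z1) := ⟨_, rfl⟩
  have hdle : ∀ u ∈ KK, d ≤ dist w u := fun u hu => by
    rw [hd_def, ← hz1]; exact infDist_le_dist_of_mem hu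
  have hdm : d < m := by
    refine (hdle _ hx0KK).trans_lt ?_
    rw [hw, dist_eq_norm]; exact hfm
  have hd0 : 0 < d := by
    rw [hd_def, dist_pos]
    intro h
    have := hq z1 ⟨hz1B, hcb hz1b⟩ y1 (hbb hy1.1)
    rw [← hw, h, sub_self, norm_zero, mul_zero] at this
    have : y1 = z1 := sub_eq_zero.1 (norm_le_zero_iff.1 this)
    exact hy1.2 (this ▸ hz1B)
  have hΔ : ∀ y ∈ closedBall x0 r, f y ∈ ball w d → y ∈ O' := by
    intro y hy hfy
    have hyB : y ∉ B := by
      intro hyB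
      have := hdle (f y) ⟨y, ⟨hyB, hy⟩, rfl⟩
      rw [mem_ball, dist_comm] at hfy
      linarith
    refine ⟨?_, hyB⟩
    have h1 := hq x0 ⟨hx0, hx0r⟩ y (hcb hy)
    have h2 : ‖f y - f x0‖ < 2 * m := by
      rw [← dist_eq_norm]
      rw [mem_ball] at hfy
      have := dist_triangle (f y) w (f x0)
      have h3 : dist w (f x0) < m := by rw [hw, dist_eq_norm]; exact hfm
      linarith
    rw [mem_ball, dist_eq_norm]
    nlinarith
  have hz1x : ‖z1 - x0‖ ≤ r / 2 := by
    have h1 := hq x0 ⟨hx0, hx0r⟩ z1 (hcb hz1b)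
    have h2 : ‖f z1 - f x0‖ < 2 * m := by
      rw [← dist_eq_norm]
      have := dist_triangle_left (f z1) (f x0) w
      rw [← hd_def] at this
      have h3 : dist w (f x0) < m := by rw [hw, dist_eq_norm]; exact hfm
      linarith
    nlinarith
  have SEG : ∀ q ∈ ball w d, ∀ y ∈ O', f y ∈ ball w d →
      ∃ y', LiftTo f O' y (fun s => f y + s • (q - f y)) y' := by
    intro q hqd y hy hfy
    have := hlh.continuation (A := fun s => f y + s • (q - f y)) (by fun_prop) hy (by simp)
      (V := 1) (isCompact_closedBall x0 r) (by
        intro v hv u hu hfu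
        refine hΔ u hu ?_
        rw [hfu]
        have := (convex_ball w d).add_smul_sub_mem hfy hqd hv
        exact this) (fun u hu => ball_subset_closedBall hu.1) 1 (right_mem_Icc.2 zero_le_one)
    simpa using this
  -- constants at z1
  have hz1O : z1 ∈ O := hBO hz1B
  obtain ⟨C, hC, hanti⟩ := (f' z1).toLinearMap.exists_antilipschitzWith
    (LinearMap.ker_eq_bot.2 (hi z1 hz1O))
  obtain ⟨c, hcc⟩ : ∃ c : ℝ, c = C := ⟨_, rfl⟩
  have hc : ∀ v, ‖v‖ ≤ c * ‖f' z1 v‖ := fun v => by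
    rw [hcc]; simpa using hanti.le_mul_dist v 0
  have hcp : 0 < c := by rw [hcc]; exact_mod_cast hC
  obtain ⟨D, hD⟩ : ∃ D, D = ‖f' z1‖ := ⟨_, rfl⟩
  have hDp : 0 ≤ D := by rw [hD]; exact norm_nonneg _
  obtain ⟨e, he⟩ : ∃ e, e = 1 / (4 * K * (D * c + 1)) := ⟨_, rfl⟩
  have hep : 0 < e := by rw [he]; positivity
  have heq : 4 * K * e * (D * c + 1) = 1 := by rw [he]; field_simp
  obtain ⟨δ, hδ, hb⟩ := Metric.eventually_nhds_iff.1 ((hd z1).isLittleO.def hep)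
  obtain ⟨τ, hτ⟩ : ∃ τ, τ = min (min δ (r / 2) / K) d / 2 := ⟨_, rfl⟩
  have hτ0 : 0 < τ := by rw [hτ]; positivity
  have hτd : τ < d := by
    have := min_le_right (min δ (r / 2) / K) d
    linarith
  have hτK : K * τ < min δ (r / 2) := by
    have h1 := min_le_left (min δ (r / 2) / K) d
    have h2 : τ < min δ (r / 2) / K := by
      have : 0 < min δ (r / 2) / K := by positivity
      linarith
    rw [lt_div_iff₀ hK] at h2
    linarith
  have hτδ : K * τ < δ := hτK.trans_le (min_le_left _ _)
  have hτr : K * τ < r / 2 := hτK.trans_le (min_le_right _ _)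
  obtain ⟨s, hs⟩ : ∃ s, s = 1 - τ / d := ⟨_, rfl⟩
  have hs1 : s < 1 := by
    have : 0 < τ / d := by positivity
    linarith
  have hs0 : 0 < s := by
    have : τ / d < 1 := (div_lt_one hd0).2 hτd
    linarith
  have hsd : (1 - s) * d = τ := by rw [hs]; field_simp; ring
  obtain ⟨w', hw'⟩ : ∃ w', w' = w + s • (f z1 - w) := ⟨_, rfl⟩
  have hd_def' : ‖f z1 - w‖ = d := by rw [hd_def, dist_comm, dist_eq_norm]
  have hw'1 : ‖w' - f z1‖ = τ := by
    have : w' - f z1 = (-(1 - s)) • (f z1 - w) := by rw [hw']; module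
    rw [this, norm_smul, hd_def', norm_neg, Real.norm_of_nonneg (by linarith), hsd]
  have hw'w : dist w' w = s * d := by
    rw [dist_eq_norm, hw', add_sub_cancel_left, norm_smul, hd_def', Real.norm_of_nonneg hs0.le]
  have hsub : ball w' τ ⊆ ball w d := by
    apply ball_subset_ball'
    rw [hw'w]; nlinarith
  have hw'm : w' ∈ ball w d := hsub (mem_ball_self hτ0)
  have hwm : w ∈ ball w d := mem_ball_self hd0
  have hf1 : f y1 ∈ ball w d := hw ▸ hwm
  have hf2 : f y2 ∈ ball w d := hfe ▸ hf1
  obtain ⟨η1, hl1⟩ := SEG w' hw'm y1 hy1 hf1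
  obtain ⟨η2, hl2⟩ := SEG w' hw'm y2 hy2 hf2
  rw [← hw] at hl1
  rw [← hfe, ← hw] at hl2
  obtain ⟨g1, c1, e10, e11, m1⟩ := hl1
  obtain ⟨g2, c2, e20, e21, m2⟩ := hl2
  have I1 : (1 : ℝ) ∈ Icc (0 : ℝ) 1 := right_mem_Icc.2 zero_le_one
  have I0 : (0 : ℝ) ∈ Icc (0 : ℝ) 1 := left_mem_Icc.2 zero_le_one
  have hη1 : η1 ∈ O' ∧ f η1 = w' := by
    have := m1 1 I1; rw [e11] at this; simpa using this
  have hη2 : η2 ∈ O' ∧ f η2 = w' := by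
    have := m2 1 I1; rw [e21] at this; simpa using this
  have hnear : ∀ η, η ∈ O' → f η = w' → ‖η - z1‖ ≤ K * τ := by
    intro η h1 h2
    have := hq z1 ⟨hz1B, hcb hz1b⟩ η (hbb h1.1)
    rwa [h2, hw'1] at this
  have hn1 := hnear η1 hη1.1 hη1.2
  have hn2 := hnear η2 hη2.1 hη2.2
  have hest : ∀ y, ‖y - z1‖ ≤ K * τ → ‖f y - f z1 - f' z1 (y - z1)‖ ≤ e * (K * τ) := by
    intro y hy
    refine (hb (y := y) ?_).trans (mul_le_mul_of_nonneg_left hy hep.le)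
    rw [dist_eq_norm]; exact hy.trans_lt hτδ
  have hdiff : ∀ y y', ‖y - z1‖ ≤ K * τ → ‖y' - z1‖ ≤ K * τ →
      ‖f y - f y' - f' z1 (y - y')‖ ≤ 2 * (e * (K * τ)) := by
    intro y y' h1 h2
    have : f y - f y' - f' z1 (y - y') = (f y - f z1 - f' z1 (y - z1)) -
        (f y' - f z1 - f' z1 (y' - z1)) := by
      simp only [map_sub]; abel
    rw [this]
    refine (norm_sub_le _ _).trans ?_
    linarith [hest y h1, hest y' h2]
  have hη12 : ‖η2 - η1‖ ≤ c * (2 * (e * (K * τ))) := by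
    have h1 := hdiff η2 η1 hn2 hn1
    rw [hη1.2, hη2.2, sub_self, zero_sub, norm_neg] at h1
    exact (hc _).trans (mul_le_mul_of_nonneg_left h1 hcp.le)
  have hσm : ∀ x ∈ Icc (0 : ℝ) 1, η1 + x • (η2 - η1) ∈ O' ∧
      f (η1 + x • (η2 - η1)) ∈ ball w d := by
    intro x hx
    set y := η1 + x • (η2 - η1) with hy
    have hyz : y ∈ closedBall z1 (K * τ) :=
      (convex_closedBall z1 (K * τ)).add_smul_sub_mem (by simpa [dist_eq_norm] using hn1)
        (by simpa [dist_eq_norm] using hn2) hx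
    rw [mem_closedBall, dist_eq_norm] at hyz
    have hyη : ‖y - η1‖ ≤ c * (2 * (e * (K * τ))) := by
      rw [hy, add_sub_cancel_left, norm_smul, Real.norm_of_nonneg hx.1]
      refine le_trans ?_ hη12
      exact mul_le_of_le_one_left (norm_nonneg _) hx.2
    have h1 := hdiff y η1 hyz hn1
    have h2 : ‖f' z1 (y - η1)‖ ≤ D * (c * (2 * (e * (K * τ)))) := by
      rw [hD]
      exact ((f' z1).le_opNorm _).trans (mul_le_mul_of_nonneg_left hyη (norm_nonneg _))
    have h3 : ‖f y - f η1‖ ≤ 2 * (e * (K * τ)) + D * (c * (2 * (e * (K * τ)))) := by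
      have : f y - f η1 = (f y - f η1 - f' z1 (y - η1)) + f' z1 (y - η1) := by abel
      rw [this]
      exact (norm_add_le _ _).trans (by linarith)
    have h4 : 2 * (e * (K * τ)) + D * (c * (2 * (e * (K * τ)))) = τ / 2 := by
      calc _ = (4 * K * e * (D * c + 1)) * (τ / 2) := by ring
        _ = _ := by rw [heq, one_mul]
    have h5 : f y ∈ ball w d := by
      apply hsub
      rw [mem_ball, dist_eq_norm, ← hη1.2]
      linarith
    refine ⟨hΔ y ?_ h5, h5⟩
    rw [mem_closedBall, dist_eq_norm]
    have : y - x0 = (y - z1) + (z1 - x0) := by abel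
    rw [this]
    refine (norm_add_le _ _).trans ?_
    linarith
  have : Nonempty E := ⟨x0⟩
  obtain ⟨Dom, Y, hDo, hYc, hl, hu⟩ := hlh.tube (B := ℝ) (σ := fun x => η1 + x • (η2 - η1))
    (γ := fun x s => f (η1 + x • (η2 - η1)) + s • (w' - f (η1 + x • (η2 - η1)))) (by fun_prop)
    (by unfold uncurry; fun_prop) (by simp)
  have hID : ∀ x ∈ Icc (0 : ℝ) 1, x ∈ Dom := by
    intro x hx
    obtain ⟨y', hy'⟩ := SEG w' hw'm _ (hσm x hx).1 (hσm x hx).2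
    exact (hu x y' hy').1
  have hYend : ∀ x ∈ Icc (0 : ℝ) 1, Y x ∈ O' ∧ f (Y x) = w' := by
    intro x hx
    obtain ⟨g, c, e0, e1, mm⟩ := hl x (hID x hx)
    have := mm 1 I1
    rw [e1] at this
    simpa using this
  have hY0 : Y 0 = η1 := by
    refine (hu 0 η1 ⟨fun _ => η1, continuousOn_const, by simp, rfl, fun s _ => ⟨hη1.1, ?_⟩⟩).2
    simp [hη1.2]
  have hY1 : Y 1 = η2 := by
    refine (hu 1 η2 ⟨fun _ => η2, continuousOn_const, by simp, rfl, fun s _ => ⟨hη2.1, ?_⟩⟩).2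
    simp [hη2.2]
  have hconst := hlh.unique isPreconnected_Icc (hYc.mono hID) (g2 := fun _ => η1)
    continuousOn_const (fun x hx => (hYend x hx).1) (fun _ _ => hη1.1)
    (fun x hx => (hYend x hx).2.trans hη1.2.symm) I0 hY0 1 I1
  have hηe : η1 = η2 := by rw [← hY1]; exact hconst.symm
  have hg := hlh.unique isPreconnected_Icc c1 c2 (fun x hx => (m1 x hx).1)
    (fun x hx => (m2 x hx).1) (fun x hx => (m1 x hx).2.trans (m2 x hx).2.symm) I1
    (by rw [e11, e21, hηe]) 0 I0
  exact hne (by rw [← e10, ← e20]; exact hg)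

theorem LH_of_inj {f : E → E} {f' : E → E →L[ℝ] E} {O : Set E} (hO : IsOpen O)
    (hd : ∀ y, HasFDerivAt f (f' y) y) (hi : ∀ y ∈ O, Injective (f' y)) : LH f O :=
  ⟨hO, continuous_iff_continuousAt.2 fun y => (hd y).continuousAt,
    fun _ hU hUo => open_of_inj hUo hd fun y hy => hi y (hU hy), loc_inj hO hd hi⟩
end locinj


theorem core_alg {k M η ts D v e1 e2 ρ : ℝ} (hk : 0 < k) (hk1 : k ≤ 1) (hM : 0 ≤ M)
    (h2 : |2 * k * v - D| ≤ 1) (he : e1 ^ 2 + e2 ^ 2 = 1) (hv0 : 0 ≤ v) (hv1 : v ≤ 1)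
    (hts : |ts| ≤ η) (hρ : 0 ≤ ρ) (hsm : M * ρ ^ 2 + 2 * M * η * ρ ≤ k / 64) :
    ∃ σ : ℝ, (σ = 1 ∨ σ = -1) ∧ ∀ h : ℝ, 0 ≤ h → h ≤ 1 →
      k / 64 * h ^ 2 ≤ (D * v - k * v ^ 2 - σ * h * e2) + k * (v - σ * h * e1) ^ 2
        - ((D - M * ts ^ 2) + M * (ts + σ * h * ρ) ^ 2) * (v - σ * h * e1) := by
  have hη : 0 ≤ η := (abs_nonneg _).trans hts
  have e1a : |e1| ≤ 1 := abs_le_of_sq_le_sq' (by linarith [sq_nonneg e2]) zero_le_one |> abs_le.2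
  obtain ⟨e1l, e1u⟩ := abs_le.1 e1a
  obtain ⟨L, hL⟩ : ∃ L, L = -e2 - (2 * k * v - D) * e1 - 2 * M * ts * v * ρ := ⟨_, rfl⟩
  obtain ⟨Q, hQ⟩ : ∃ Q, Q = k * e1 ^ 2 - M * v * ρ ^ 2 + 2 * M * ts * e1 * ρ := ⟨_, rfl⟩
  have hMρ : 0 ≤ M * ρ ^ 2 := by positivity
  have hMη : 0 ≤ 2 * M * η * ρ := by positivity
  have hMρk : M * ρ ^ 2 ≤ k / 64 := by linarith
  -- bound on the t-terms
  have b1 : |2 * M * ts * e1 * ρ| ≤ 2 * M * η * ρ := by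
    have : |2 * M * ts * e1 * ρ| = (2 * M * ρ) * (|ts| * |e1|) := by
      rw [show 2 * M * ts * e1 * ρ = (2 * M * ρ) * (ts * e1) by ring, abs_mul,
        abs_of_nonneg (by positivity : 0 ≤ 2 * M * ρ), abs_mul]
    rw [this]
    calc (2 * M * ρ) * (|ts| * |e1|) ≤ (2 * M * ρ) * (η * 1) := by gcongr
      _ = _ := by ring
  have b2 : |2 * M * ts * v * ρ| ≤ 2 * M * η * ρ := by
    have : |2 * M * ts * v * ρ| = (2 * M * ρ) * (|ts| * v) := by
      rw [show 2 * M * ts * v * ρ = (2 * M * ρ) * (ts * v) by ring, abs_mul,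
        abs_of_nonneg (by positivity : 0 ≤ 2 * M * ρ), abs_mul, abs_of_nonneg hv0]
    rw [this]
    calc (2 * M * ρ) * (|ts| * v) ≤ (2 * M * ρ) * (η * 1) := by gcongr
      _ = _ := by ring
  have b3 : M * v * ρ ^ 2 ≤ M * ρ ^ 2 := by linarith [mul_nonneg hMρ (sub_nonneg.2 hv1)]
  have hQl : k * e1 ^ 2 - k / 64 ≤ Q := by
    have := (abs_le.1 b1).1
    rw [hQ]; linarith
  have key : ∀ σ : ℝ, (σ = 1 ∨ σ = -1) → 0 ≤ σ * L → ∀ h : ℝ, 0 ≤ h → h ≤ 1 →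
      k / 64 * h ^ 2 ≤ (D * v - k * v ^ 2 - σ * h * e2) + k * (v - σ * h * e1) ^ 2
        - ((D - M * ts ^ 2) + M * (ts + σ * h * ρ) ^ 2) * (v - σ * h * e1) := by
    intro σ hσ hσL h h0 h1
    have hs2 : σ ^ 2 = 1 := by rcases hσ with rfl | rfl <;> norm_num
    have hs3 : σ ^ 3 = σ := by rw [pow_succ, hs2, one_mul]
    have hid : (D * v - k * v ^ 2 - σ * h * e2) + k * (v - σ * h * e1) ^ 2
        - ((D - M * ts ^ 2) + M * (ts + σ * h * ρ) ^ 2) * (v - σ * h * e1)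
        = h * (σ * L) + h ^ 2 * Q + h ^ 3 * (σ * (M * e1 * ρ ^ 2)) := by
      rw [hL, hQ]
      linear_combination (k * h ^ 2 * e1 ^ 2 - M * h ^ 2 * ρ ^ 2 * v
        + 2 * M * ts * h ^ 2 * ρ * e1) * hs2 + (M * h ^ 3 * ρ ^ 2 * e1) * hs3
    rw [hid]
    have hc : -(M * ρ ^ 2) ≤ σ * (M * e1 * ρ ^ 2) := by
      have p1 := mul_nonneg hMρ (by linarith : 0 ≤ 1 + e1)
      have p2 := mul_nonneg hMρ (by linarith : 0 ≤ 1 - e1)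
      rcases hσ with rfl | rfl <;> linarith
    have hh3 : h ^ 3 ≤ h ^ 2 := by linarith [mul_nonneg (sq_nonneg h) (sub_nonneg.2 h1)]
    have hc3 : -(h ^ 2 * (k / 64)) ≤ h ^ 3 * (σ * (M * e1 * ρ ^ 2)) := by
      have h5 : h ^ 3 * -(M * ρ ^ 2) ≤ h ^ 3 * (σ * (M * e1 * ρ ^ 2)) :=
        mul_le_mul_of_nonneg_left hc (by positivity)
      have h6 : h ^ 3 * (M * ρ ^ 2) ≤ h ^ 2 * (k / 64) :=
        mul_le_mul hh3 hMρk hMρ (by positivity)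
      linarith
    have hq2 : h ^ 2 * (k * e1 ^ 2 - k / 64) ≤ h ^ 2 * Q :=
      mul_le_mul_of_nonneg_left hQl (by positivity)
    rcases le_or_gt (1 / 16) (e1 ^ 2) with hc1 | hc1
    · have : 0 ≤ h * (σ * L) := mul_nonneg h0 hσL
      have : h ^ 2 * (k * (1 / 16)) ≤ h ^ 2 * (k * e1 ^ 2) := by gcongr
      have hp : 0 ≤ h ^ 2 * k := by positivity
      linarith
    · have ha : |e1| ≤ 1 / 4 := abs_le.2 (abs_le_of_sq_le_sq' (by norm_num at hc1 ⊢; linarith) (by norm_num))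
      have hb : 3 / 4 ≤ |e2| := by
        have : (3 / 4 : ℝ) ^ 2 ≤ |e2| ^ 2 := by rw [sq_abs]; norm_num at hc1 ⊢; linarith
        exact le_of_sq_le_sq this (abs_nonneg _)
      have hLa : |e2| ≤ |L| + |e1| + 2 * M * η * ρ := by
        have h7 : |(2 * k * v - D) * e1| ≤ |e1| := by
          rw [abs_mul]; exact mul_le_of_le_one_left (abs_nonneg _) h2
        have h8 : e2 = -(L + ((2 * k * v - D) * e1) + 2 * M * ts * v * ρ) := by rw [hL]; ring
        rw [h8, abs_neg]
        refine (abs_add_le _ _).trans ?_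
        have := abs_add_le L ((2 * k * v - D) * e1)
        linarith
      have hLs : |L| = σ * L := by
        rw [← abs_of_nonneg hσL, abs_mul]
        rcases hσ with rfl | rfl <;> simp
      have hL4 : 1 / 4 ≤ σ * L := by rw [← hLs]; linarith
      have h9 : h * (1 / 4) ≤ h * (σ * L) := mul_le_mul_of_nonneg_left hL4 h0
      have h10 : h ^ 2 ≤ h := by linarith [mul_nonneg h0 (sub_nonneg.2 h1)]
      have h11 : 0 ≤ h ^ 2 * (k * e1 ^ 2) := by positivity
      have h12 : h ^ 2 * k ≤ h ^ 2 := mul_le_of_le_one_right (by positivity) hk1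
      linarith
  rcases le_total 0 L with h | h
  · exact ⟨1, Or.inl rfl, key 1 (Or.inl rfl) (by linarith)⟩
  · exact ⟨-1, Or.inr rfl, key (-1) (Or.inr rfl) (by linarith)⟩


/-- the suspended family -/
def Phi (X : ℂ → ℂ) : ℂ × ℝ → ℂ × ℝ := fun p => (X p.1 - (p.2 : ℂ) * p.1, p.2)

/-- the parameter strip -/
def Om (ε : ℝ) : Set (ℂ × ℝ) := {p | |p.2| < ε}

/-- parabolic arcs -/
def arc (c k r : ℝ) : ℂ := (r : ℂ) + ((c * r - k * r ^ 2 : ℝ) : ℂ) * Complex.I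

theorem arc_re (c k r : ℝ) : (arc c k r).re = r := by
  simp only [arc, Complex.add_re, Complex.mul_re, Complex.ofReal_re, Complex.ofReal_im, Complex.I_re,
    Complex.I_im]; ring
theorem arc_im (c k r : ℝ) : (arc c k r).im = c * r - k * r ^ 2 := by
  simp only [arc, Complex.add_im, Complex.mul_im, Complex.ofReal_re, Complex.ofReal_im, Complex.I_re,
    Complex.I_im]; ring

set_option maxHeartbeats 1600000 in
theorem escape {X : ℂ → ℂ} {ε : ℝ} (hlh : LH (Phi X) (Om ε)) {Dom : Set (ℝ × ℝ × ℝ × ℝ)}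
    {Y : ℝ × ℝ × ℝ × ℝ → ℂ × ℝ} (hYc : ContinuousOn Y Dom)
    (hF : ∀ t c k v, (t, c, k, v) ∈ Dom → Y (t, c, k, v) ∈ Om ε ∧
      Phi X (Y (t, c, k, v)) = (arc c k v, t))
    (hI : ∀ t c k v v', (t, c, k, v) ∈ Dom → 0 ≤ v' → v' ≤ v → (t, c, k, v') ∈ Dom)
    {k M η m0 v1 v2 ts D vs : ℝ} (hk : 0 < k) (hk1 : k ≤ 1 / 2) (hM : 0 ≤ M)
    (hD0 : 0 ≤ D) (hD1 : D ≤ 1) (hDm : D < m0 - η) (hcs : 0 ≤ D - M * ts ^ 2) (hts : |ts| < η)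
    (hvs : 0 < vs) (hvs1 : vs ≤ v1) (hv12 : v1 < v2) (hv2 : v2 ≤ 1)
    (hT : ∀ t c, |t| ≤ η → 0 ≤ c → c ≤ m0 + η → D - M * ts ^ 2 < c - M * t ^ 2 →
      (t, c, k, v2) ∈ Dom)
    (hd : ∀ v, 0 ≤ v → v < vs → (ts, D, k, v) ∈ Dom) :
    ∃ R, ∀ v ∈ Ioo (vs / 2) vs, ‖Y (ts, D, k, v)‖ ≤ R := by
  have hη : 0 < η := (abs_nonneg _).trans_lt hts
  obtain ⟨r, hr_def⟩ : ∃ r, r = min (min (vs / 4) (v2 - v1)) (min 1 (η * vs / 16)) := ⟨_, rfl⟩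
  have hr : 0 < r := by
    have : 0 < v2 - v1 := by linarith
    rw [hr_def]; positivity
  have r1 : r ≤ vs / 4 := by rw [hr_def]; exact (min_le_left _ _).trans (min_le_left _ _)
  have r2 : r ≤ v2 - v1 := by rw [hr_def]; exact (min_le_left _ _).trans (min_le_right _ _)
  have r3 : r ≤ 1 := by rw [hr_def]; exact (min_le_right _ _).trans (min_le_left _ _)
  have r4 : r ≤ η * vs / 16 := by rw [hr_def]; exact (min_le_right _ _).trans (min_le_right _ _)
  -- compact set
  set KK : Set (ℝ × ℝ × ℝ × ℝ) :=
    (Icc (-η) η ×ˢ Icc 0 (m0 + η) ×ˢ Icc k k ×ˢ Icc 0 v2) ∩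
      {p | D - M * ts ^ 2 + k / 64 * r ^ 2 ≤ p.2.1 - M * p.1 ^ 2} with hKK
  have hKc : IsCompact KK := by
    refine IsCompact.inter_right ?_ (isClosed_le (by fun_prop) (by fun_prop))
    exact isCompact_Icc.prod (isCompact_Icc.prod (isCompact_Icc.prod isCompact_Icc))
  have hKD : KK ⊆ Dom := by
    rintro ⟨t, c, k', v⟩ ⟨⟨h1, h2, h3, h4⟩, h5⟩
    have hkk : k' = k := le_antisymm h3.2 h3.1
    subst hkk
    have h5' : D - M * ts ^ 2 + k' / 64 * r ^ 2 ≤ c - M * t ^ 2 := h5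
    have hp : 0 < k' / 64 * r ^ 2 := by positivity
    exact hI _ _ _ _ _ (hT t c (abs_le.2 h1) h2.1 h2.2 (by linarith)) h4.1 h4.2
  obtain ⟨Bd, hBd⟩ := hKc.exists_bound_of_continuousOn (hYc.mono hKD)
  obtain ⟨ρ0, hρ0d⟩ : ∃ ρ0, ρ0 = min (min 1 (k / 64 / (M + 2 * M * η + 1))) (η - |ts|) := ⟨_, rfl⟩
  have hρ0 : 0 < ρ0 := by
    have : 0 < η - |ts| := by linarith
    rw [hρ0d]; positivity
  have q1 : ρ0 ≤ 1 := by rw [hρ0d]; exact (min_le_left _ _).trans (min_le_left _ _)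
  have q2 : ρ0 ≤ k / 64 / (M + 2 * M * η + 1) := by
    rw [hρ0d]; exact (min_le_left _ _).trans (min_le_right _ _)
  have q3 : ρ0 ≤ η - |ts| := by rw [hρ0d]; exact min_le_right _ _
  refine ⟨max (max Bd (1 / ρ0)) η, fun v hv => ?_⟩
  by_contra hcon
  rw [not_le, max_lt_iff, max_lt_iff] at hcon
  obtain ⟨⟨n1, n2⟩, n3⟩ := hcon
  have hvv : 0 < v := by linarith [hv.1]
  have hvD := hd v hvv.le hv.2
  obtain ⟨hYO, hYP⟩ := hF _ _ _ _ hvD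
  have hY2 : (Y (ts, D, k, v)).2 = ts := congrArg Prod.snd hYP
  obtain ⟨z, hz⟩ : ∃ z, z = (Y (ts, D, k, v)).1 := ⟨_, rfl⟩
  have hYz : Y (ts, D, k, v) = (z, ts) := Prod.ext hz.symm hY2
  have hXz : X z - (ts : ℂ) * z = arc D k v := by
    have := congrArg Prod.fst hYP
    rw [hYz] at this; exact this
  have hnz : ‖Y (ts, D, k, v)‖ = ‖z‖ := by
    rw [hYz, Prod.norm_mk, max_eq_left]
    rw [hYz, Prod.norm_mk, lt_max_iff, Real.norm_eq_abs] at n3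
    rcases n3 with h | h
    · rw [Real.norm_eq_abs]; linarith
    · linarith
  rw [hnz] at n1 n2
  obtain ⟨N, hN⟩ : ∃ N, N = ‖z‖ := ⟨_, rfl⟩
  rw [← hN] at n1 n2
  have hNp : 0 < N := lt_trans (by positivity) n2
  obtain ⟨ρ, hρd⟩ : ∃ ρ, ρ = 1 / N := ⟨_, rfl⟩
  have hρ : 0 < ρ := by rw [hρd]; positivity
  have hρρ : ρ ≤ ρ0 := by
    rw [hρd, one_div_le hNp hρ0]; exact n2.le
  obtain ⟨e1, he1⟩ : ∃ e1, e1 = z.re * ρ := ⟨_, rfl⟩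
  obtain ⟨e2, he2⟩ : ∃ e2, e2 = z.im * ρ := ⟨_, rfl⟩
  have hee : e1 ^ 2 + e2 ^ 2 = 1 := by
    have h1 : N ^ 2 = z.re ^ 2 + z.im ^ 2 := by
      rw [hN, Complex.sq_norm, Complex.normSq_apply]; ring
    have h2 : N * ρ = 1 := by rw [hρd]; field_simp
    calc e1 ^ 2 + e2 ^ 2 = (z.re ^ 2 + z.im ^ 2) * ρ ^ 2 := by rw [he1, he2]; ring
      _ = (N * ρ) ^ 2 := by rw [← h1]; ring
      _ = 1 := by rw [h2]; norm_num
  have hsm : M * ρ ^ 2 + 2 * M * η * ρ ≤ k / 64 := by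
    have hW : 0 < M + 2 * M * η + 1 := by positivity
    have h1 : ρ * (M + 2 * M * η + 1) ≤ k / 64 := by
      rw [← le_div_iff₀ hW]; linarith
    have h2 : ρ ^ 2 ≤ ρ := by
      linarith [mul_nonneg hρ.le (sub_nonneg.2 (hρρ.trans q1))]
    have h3 : M * ρ ^ 2 ≤ M * ρ := mul_le_mul_of_nonneg_left h2 hM
    linarith
  have hv1' : v ≤ 1 := by linarith [hv.2]
  have hkv : 0 ≤ k * v ∧ k * v ≤ 1 / 2 := ⟨by positivity, by
    linarith [mul_nonneg hk.le (sub_nonneg.2 hv1')]⟩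
  have habs : |2 * k * v - D| ≤ 1 := abs_le.2 ⟨by linarith [hkv.1], by linarith [hkv.2]⟩
  obtain ⟨σ, hσ, halg⟩ := core_alg hk (by linarith) hM habs hee hvv.le hv1' hts.le hρ.le hsm
  have e1a : |e1| ≤ 1 := abs_le.2 (abs_le_of_sq_le_sq' (by linarith [sq_nonneg e2]) zero_le_one)
  have e2a : |e2| ≤ 1 := abs_le.2 (abs_le_of_sq_le_sq' (by linarith [sq_nonneg e1]) zero_le_one)
  have hσa : |σ| = 1 := by rcases hσ with rfl | rfl <;> simp
  have hs1 : ∀ h, 0 ≤ h → |σ * h * e1| ≤ h := by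
    intro h h0
    rw [abs_mul, abs_mul, hσa, one_mul, abs_of_nonneg h0]
    exact mul_le_of_le_one_right h0 e1a
  have hs2 : ∀ h, 0 ≤ h → |σ * h * e2| ≤ h := by
    intro h h0
    rw [abs_mul, abs_mul, hσa, one_mul, abs_of_nonneg h0]
    exact mul_le_of_le_one_right h0 e2a
  set V : ℝ → ℝ := fun h => v - σ * h * e1 with hV
  set c : ℝ → ℝ := fun h => (D * v - k * v ^ 2 - σ * h * e2) / V h + k * V h with hc
  set T : ℝ → ℝ := fun h => ts + σ * h * ρ with hTd
  have hV1 : ∀ h ∈ Icc 0 r, vs / 4 ≤ V h := by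
    intro h hh
    have := (abs_le.1 (hs1 h hh.1)).2
    simp only [hV]; linarith [hh.2, hv.1]
  have hVp : ∀ h ∈ Icc 0 r, 0 < V h := fun h hh => by linarith [hV1 h hh]
  have hV2 : ∀ h ∈ Icc 0 r, V h ≤ v2 := by
    intro h hh
    have := (abs_le.1 (hs1 h hh.1)).1
    simp only [hV]; linarith [hh.2, hv.2]
  have hcV : ∀ h ∈ Icc 0 r, c h * V h = D * v - k * v ^ 2 - σ * h * e2 + k * V h ^ 2 := by
    intro h hh
    have := (hVp h hh).ne'
    simp only [hc]; field_simp
  have hTa : ∀ h ∈ Icc 0 r, |T h| ≤ η := by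
    intro h hh
    have h1 : |σ * h * ρ| ≤ ρ := by
      rw [abs_mul, abs_mul, hσa, one_mul, abs_of_nonneg hh.1, abs_of_nonneg hρ.le]
      exact mul_le_of_le_one_left hρ.le (hh.2.trans r3)
    refine (abs_add_le _ _).trans ?_
    linarith
  have hlow : ∀ h ∈ Icc 0 r, D - M * ts ^ 2 + k / 64 * h ^ 2 ≤ c h - M * T h ^ 2 := by
    intro h hh
    have h1 := halg h hh.1 (hh.2.trans r3)
    have h2 : k / 64 * h ^ 2 ≤ (c h - M * T h ^ 2 - (D - M * ts ^ 2)) * V h := by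
      have := hcV h hh
      simp only [hTd, hV] at this ⊢
      linarith
    have hp : 0 ≤ k / 64 * h ^ 2 := by positivity
    have h3 : 0 ≤ c h - M * T h ^ 2 - (D - M * ts ^ 2) := by
      by_contra hneg
      have := mul_neg_of_neg_of_pos (not_le.1 hneg) (hVp h hh)
      linarith
    have h4 := mul_le_of_le_one_right h3 ((hV2 h hh).trans hv2)
    linarith
  have hup : ∀ h ∈ Icc 0 r, c h ≤ m0 + η := by
    intro h hh
    have h1 : (c h - D) * V h ≤ η * V h := by
      have h2 : (c h - D) * V h = -(σ * h * e2) - (2 * k * v - D) * (σ * h * e1)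
          + k * (σ * h * e1) ^ 2 := by
        rw [sub_mul, hcV h hh]; simp only [hV]; ring
      have h3 := (abs_le.1 (hs2 h hh.1)).1
      have h4 : |(2 * k * v - D) * (σ * h * e1)| ≤ h := by
        rw [abs_mul]
        calc _ ≤ 1 * h := mul_le_mul habs (hs1 h hh.1) (abs_nonneg _) zero_le_one
          _ = h := one_mul h
      have h4' := (abs_le.1 h4).1
      have h5 : k * (σ * h * e1) ^ 2 ≤ h := by
        have h6 : (σ * h * e1) ^ 2 ≤ h ^ 2 := sq_le_sq' (abs_le.1 (hs1 h hh.1)).1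
          (abs_le.1 (hs1 h hh.1)).2
        have h7 : h ^ 2 ≤ h := by
          linarith [mul_nonneg hh.1 (sub_nonneg.2 (hh.2.trans r3))]
        have h8 : k * (σ * h * e1) ^ 2 ≤ 1 * (σ * h * e1) ^ 2 :=
          mul_le_mul_of_nonneg_right (by linarith) (sq_nonneg _)
        linarith
      have h9 : η * (vs / 4) ≤ η * V h := mul_le_mul_of_nonneg_left (hV1 h hh) hη.le
      have := hh.2
      linarith
    have := le_of_mul_le_mul_right h1 (hVp h hh)
    linarith
  have hlo0 : ∀ h ∈ Icc 0 r, 0 ≤ c h := by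
    intro h hh
    have h1 := hlow h hh
    have : 0 ≤ k / 64 * h ^ 2 := by positivity
    have : 0 ≤ M * T h ^ 2 := by positivity
    linarith
  have hbD : ∀ h ∈ Icc 0 r, (T h, c h, k, V h) ∈ Dom := by
    intro h hh
    rcases eq_or_lt_of_le hh.1 with rfl | hpos
    · have e1 : T 0 = ts := by simp [hTd]
      have e2 : V 0 = v := by simp [hV]
      have e3 : c 0 = D := by simp only [hc, e2]; field_simp; ring
      rw [e1, e2, e3]; exact hvD
    · have : 0 < k / 64 * h ^ 2 := by positivity
      exact hI _ _ _ _ _ (hT _ _ (hTa h hh) (hlo0 h hh) (hup h hh) (by linarith [hlow h hh]))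
        (hVp h hh).le (hV2 h hh)
  have hbc : ContinuousOn (fun h => (T h, c h, k, V h)) (Icc 0 r) := by
    have hVc : ContinuousOn V (Icc 0 r) := by simp only [hV]; fun_prop
    have hcc : ContinuousOn c (Icc 0 r) := by
      simp only [hc]
      refine ContinuousOn.add (ContinuousOn.div (by fun_prop) hVc fun h hh => (hVp h hh).ne') ?_
      exact continuousOn_const.mul hVc
    have hTc : ContinuousOn T (Icc 0 r) := by simp only [hTd]; fun_prop
    exact hTc.prodMk (hcc.prodMk (continuousOn_const.prodMk hVc))
  have I0 : (0 : ℝ) ∈ Icc 0 r := left_mem_Icc.2 hr.le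
  have Ir : r ∈ Icc 0 r := right_mem_Icc.2 hr.le
  have huniq := hlh.unique isPreconnected_Icc (g1 := fun h => Y (T h, c h, k, V h))
    (g2 := fun h => (z, T h)) (hYc.comp hbc hbD)
    (by simp only [hTd]; fun_prop) (fun h hh => (hF _ _ _ _ (hbD h hh)).1)
    (by
      intro h hh
      have h1 := hF _ _ _ _ (hbD h hh)
      have h2 : (Y (T h, c h, k, V h)).2 = T h := congrArg Prod.snd h1.2
      have h3 : |(Y (T h, c h, k, V h)).2| < ε := h1.1
      rw [h2] at h3; exact h3)
    (by
      intro h hh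
      rw [(hF _ _ _ _ (hbD h hh)).2]
      refine Prod.ext ?_ rfl
      change arc (c h) k (V h) = X z - (T h : ℂ) * z
      have hX : X z = arc D k v + (ts : ℂ) * z := by rw [← hXz]; ring
      rw [hX]
      apply Complex.ext
      · simp only [arc_re, Complex.sub_re, Complex.add_re, Complex.mul_re, Complex.ofReal_re,
          Complex.ofReal_im, zero_mul, sub_zero, hTd, hV, he1]
        ring
      · have := hcV h hh
        simp only [arc_im, Complex.sub_im, Complex.add_im, Complex.mul_im, Complex.ofReal_re,
          Complex.ofReal_im, zero_mul, add_zero]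
        rw [this]
        simp only [hTd, he2]
        ring)
    I0 (by
      have e1 : T 0 = ts := by simp [hTd]
      have e2 : V 0 = v := by simp [hV]
      have e3 : c 0 = D := by simp only [hc, e2]; field_simp; ring
      simp only [e1, e2, e3]; exact hYz) r Ir
  have hfin := hBd (T r, c r, k, V r) ⟨⟨abs_le.1 (hTa r Ir), ⟨hlo0 r Ir, hup r Ir⟩, ⟨le_rfl, le_rfl⟩,
    (hVp r Ir).le, hV2 r Ir⟩, hlow r Ir⟩
  rw [huniq, Prod.norm_mk] at hfin
  have := (le_max_left _ _).trans hfin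
  linarith


/-- the point `z` is reached by lifting the segment from `0` to `X z` -/
def InV (X : ℂ → ℂ) (ε : ℝ) (z : ℂ) : Prop :=
  LiftTo (Phi X) (Om ε) (0, 0) (fun s => ((s : ℂ) * X z, 0)) (z, 0)

theorem continuous_arc : Continuous (fun p : ℝ × ℝ × ℝ => arc p.1 p.2.1 p.2.2) := by
  unfold arc; fun_prop

/-- data of the tube of arcs -/
structure ArcTube (X : ℂ → ℂ) (ε : ℝ) (Dom : Set (ℝ × ℝ × ℝ × ℝ))
    (Y : ℝ × ℝ × ℝ × ℝ → ℂ × ℝ) : Prop where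
  opn : IsOpen Dom
  cont : ContinuousOn Y Dom
  F : ∀ t c k v, (t, c, k, v) ∈ Dom → Y (t, c, k, v) ∈ Om ε ∧
      Phi X (Y (t, c, k, v)) = (arc c k v, t)
  I : ∀ t c k v v', (t, c, k, v) ∈ Dom → 0 ≤ v' → v' ≤ v → (t, c, k, v') ∈ Dom
  L : ∀ t c k v, (t, c, k, v) ∈ Dom →
    LiftTo (Phi X) (Om ε) (0, t) (fun s => (arc c k (s * v), t)) (Y (t, c, k, v))
  U : ∀ t c k v y, LiftTo (Phi X) (Om ε) (0, t) (fun s => (arc c k (s * v), t)) y →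
    (t, c, k, v) ∈ Dom ∧ Y (t, c, k, v) = y

theorem exists_arcTube {X : ℂ → ℂ} {ε : ℝ} (hlh : LH (Phi X) (Om ε)) (hX0 : X 0 = 0) :
    ∃ Dom Y, ArcTube X ε Dom Y := by
  have hc1 : Continuous fun p : (ℝ × ℝ × ℝ × ℝ) × ℝ =>
      arc p.1.2.1 p.1.2.2.1 (p.2 * p.1.2.2.2) := by unfold arc; fun_prop
  obtain ⟨Dom, Y, h1, h2, h3, h4⟩ := hlh.tube (B := ℝ × ℝ × ℝ × ℝ) (σ := fun b => ((0 : ℂ), b.1))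
    (γ := fun b s => (arc b.2.1 b.2.2.1 (s * b.2.2.2), b.1)) (by fun_prop)
    (by
      change Continuous fun p : (ℝ × ℝ × ℝ × ℝ) × ℝ =>
        (arc p.1.2.1 p.1.2.2.1 (p.2 * p.1.2.2.2), p.1.1)
      exact hc1.prodMk (by fun_prop))
    (by intro b; simp [Phi, hX0, arc])
  refine ⟨Dom, Y, h1, h2, ?_, ?_, fun t c k v h => h3 _ h, fun t c k v y h => h4 _ _ h⟩
  · intro t c k v h
    obtain ⟨g, -, -, e1, m⟩ := h3 _ h
    have := m 1 (right_mem_Icc.2 zero_le_one)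
    rw [e1] at this
    simpa using this
  · intro t c k v v' h hv hvv
    obtain ⟨y, hy⟩ := LiftTo.initial (A := fun r => (arc c k r, t)) hv hvv (h3 _ h)
    exact (h4 (t, c, k, v') y hy).1

/-- agreement with a local inverse along a path of parameters -/
theorem ArcTube.agree {X : ℂ → ℂ} {ε : ℝ} (hlh : LH (Phi X) (Om ε)) {Dom : Set (ℝ × ℝ × ℝ × ℝ)}
    {Y : ℝ × ℝ × ℝ × ℝ → ℂ × ℝ} (hT : ArcTube X ε Dom Y) {W : Set (ℂ × ℝ)} {J : ℂ × ℝ → ℂ × ℝ}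
    (hJ : ContinuousOn J W) (hJO : ∀ w ∈ W, J w ∈ Om ε ∧ Phi X (J w) = w)
    {t c k v : ℝ → ℝ} (ht : Continuous t) (hc : Continuous c) (hk : Continuous k)
    (hv : Continuous v) (hD : ∀ s ∈ Icc (0 : ℝ) 1, (t s, c s, k s, v s) ∈ Dom)
    (hW : ∀ s ∈ Icc (0 : ℝ) 1, (arc (c s) (k s) (v s), t s) ∈ W) {s0 : ℝ} (hs0 : s0 ∈ Icc (0 : ℝ) 1)
    (h0 : Y (t s0, c s0, k s0, v s0) = J (arc (c s0) (k s0) (v s0), t s0)) :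
    ∀ s ∈ Icc (0 : ℝ) 1, Y (t s, c s, k s, v s) = J (arc (c s) (k s) (v s), t s) := by
  have hac : Continuous fun s => (arc (c s) (k s) (v s), t s) :=
    (continuous_arc.comp (hc.prodMk (hk.prodMk hv))).prodMk ht
  refine hlh.unique isPreconnected_Icc (g1 := fun s => Y (t s, c s, k s, v s))
    (g2 := fun s => J (arc (c s) (k s) (v s), t s))
    (hT.cont.comp (Continuous.continuousOn (by fun_prop)) hD)
    (hJ.comp hac.continuousOn hW) (fun s hs => (hT.F _ _ _ _ (hD s hs)).1)
    (fun s hs => (hJO _ (hW s hs)).1) ?_ hs0 h0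
  intro s hs
  rw [(hT.F _ _ _ _ (hD s hs)).2, (hJO _ (hW s hs)).2]

theorem box_mem {δ c k v : ℝ} (hδ : 0 < δ) (hδ2 : δ < 1 / 2) (hc0 : 0 ≤ c) (hc : c ≤ 5 * δ / 16)
    (hk0 : 0 ≤ k) (hk : k ≤ δ / 16) (hv : 1 - δ / 2 ≤ v) (hv2 : v ≤ 1 + δ / 8) :
    |(arc c k v).re - 1| < δ ∧ |(arc c k v).im| < δ := by
  rw [arc_re, arc_im]
  have v0 : 0 ≤ v := by linarith
  have v2 : v ≤ 9 / 8 := by linarith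
  have h1 : c * v ≤ 5 * δ / 16 * (9 / 8) := by gcongr
  have h2 : 0 ≤ c * v := by positivity
  have h3 : k * v ^ 2 ≤ δ / 16 * (9 / 8) ^ 2 := by gcongr
  have h4 : 0 ≤ k * v ^ 2 := by positivity
  constructor <;> rw [abs_lt] <;> constructor <;> linarith

set_option maxHeartbeats 1600000 in
theorem lemmaK {X : ℂ → ℂ} {ε : ℝ} (hε : 0 < ε) (hlh : LH (Phi X) (Om ε)) (hX0 : X 0 = 0)
    {z : ℂ} (hz : X z = 1) (hfr : ∃ᶠ z' in 𝓝 z, InV X ε z' ∧ 0 ≤ (X z').im) : InV X ε z := by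
  obtain ⟨Dom, Y, hT⟩ := exists_arcTube hlh hX0
  have hzO : (z, (0 : ℝ)) ∈ Om ε := by simpa [Om] using hε
  obtain ⟨U, hUo, hzU, hUO, -, hWo, J, hJc, hJU, hJl⟩ := hlh.inverse hzO univ_mem
  set W := Phi X '' U with hWd
  have hJO : ∀ w ∈ W, J w ∈ Om ε ∧ Phi X (J w) = w := fun w hw => ⟨hUO (hJU w hw).1, (hJU w hw).2⟩
  have hPz : Phi X (z, 0) = (1, 0) := by simp [Phi, hz]
  have h1W : ((1 : ℂ), (0 : ℝ)) ∈ W := ⟨_, hzU, hPz⟩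
  have hJ1 : J (1, 0) = (z, 0) := by rw [← hPz]; exact hJl _ hzU
  -- the box
  obtain ⟨δ, hδ, hδ2, hbox⟩ : ∃ δ : ℝ, 0 < δ ∧ δ < 1 / 2 ∧ ∀ (w : ℂ) (t : ℝ), |w.re - 1| < δ →
      |w.im| < δ → |t| < δ → (w, t) ∈ W := by
    obtain ⟨r, hr, hrW⟩ := Metric.isOpen_iff.1 hWo _ h1W
    refine ⟨min (r / 2) (1 / 4), by positivity, (min_le_right _ _).trans_lt (by norm_num), ?_⟩
    intro w t h1 h2 h3
    have hm := min_le_left (r / 2) (1 / 4)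
    apply hrW
    rw [mem_ball, Prod.dist_eq, max_lt_iff]
    constructor
    · rw [Complex.dist_eq]
      refine (Complex.norm_le_abs_re_add_abs_im _).trans_lt ?_
      simp only [Complex.sub_re, Complex.sub_im, Complex.one_re, Complex.one_im, sub_zero]
      linarith
    · rw [Real.dist_eq, sub_zero]; linarith
  -- choose z'
  have hXc : Continuous X := by
    have : X = fun z => (Phi X (z, 0)).1 := by funext z; simp [Phi]
    rw [this]
    exact continuous_fst.comp (hlh.cont.comp (by fun_prop))
  have ev1 : ∀ᶠ z' in 𝓝 z, (z', (0 : ℝ)) ∈ U :=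
    ((Continuous.prodMk_left (0 : ℝ)).continuousAt (x := z)).eventually (hUo.mem_nhds hzU)
  have ev2 : ∀ᶠ z' in 𝓝 z, |(X z').re - 1| < δ / 8 := by
    have : Tendsto (fun z' => |(X z').re - 1|) (𝓝 z) (𝓝 |(X z).re - 1|) :=
      (Continuous.tendsto (by fun_prop) z)
    refine this.eventually_lt_const ?_
    rw [hz]; simp; linarith
  have ev3 : ∀ᶠ z' in 𝓝 z, |(X z').im| < δ / 8 := by
    have : Tendsto (fun z' => |(X z').im|) (𝓝 z) (𝓝 |(X z).im|) :=
      (Continuous.tendsto (by fun_prop) z)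
    refine this.eventually_lt_const ?_
    rw [hz]; simp; linarith
  obtain ⟨z', ⟨hzV, hb0⟩, hz'U, ha1, hb1⟩ := (hfr.and_eventually (ev1.and (ev2.and ev3))).exists
  obtain ⟨a, ha⟩ : ∃ a, a = (X z').re := ⟨_, rfl⟩
  obtain ⟨b, hb⟩ : ∃ b, b = (X z').im := ⟨_, rfl⟩
  rw [← ha] at ha1
  rw [← hb] at hb0 hb1
  rw [abs_of_nonneg hb0] at hb1
  obtain ⟨a1, a2⟩ := abs_lt.1 ha1
  have ha0 : 0 < a := by linarith
  obtain ⟨m0, hm0⟩ : ∃ m0, m0 = b / a := ⟨_, rfl⟩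
  have hm0' : m0 * a = b := by rw [hm0]; field_simp
  have m00 : 0 ≤ m0 := by rw [hm0]; positivity
  have m01 : m0 ≤ δ / 4 := by
    rw [hm0, div_le_iff₀ ha0]
    have : δ / 4 * (1 / 2) ≤ δ / 4 * a := mul_le_mul_of_nonneg_left (by linarith) (by linarith)
    linarith
  have harc : ∀ s : ℝ, arc m0 0 (s * a) = (s : ℂ) * X z' := by
    intro s
    apply Complex.ext
    · rw [arc_re]; simp [ha]
    · rw [arc_im]; simp only [Complex.mul_im, Complex.ofReal_re, Complex.ofReal_im, ← hb, ← hm0']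
      ring
  have hbase : (0, m0, 0, a) ∈ Dom ∧ Y (0, m0, 0, a) = (z', 0) := by
    apply hT.U
    simp only [harc]
    exact hzV
  have hbaseJ : Y (0, m0, 0, a) = J (arc m0 0 a, 0) := by
    have h1 := harc 1
    rw [one_mul] at h1
    rw [hbase.2, h1]
    have : Phi X (z', 0) = (((1 : ℝ) : ℂ) * X z', 0) := by simp [Phi]
    rw [← this, hJl _ hz'U]
  -- choose η
  obtain ⟨η, hη, hη1, hηD⟩ : ∃ η : ℝ, 0 < η ∧ η ≤ δ / 16 ∧ ∀ t c k v, |t| ≤ η → |c - m0| ≤ η →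
      |k| ≤ η → 0 ≤ v → v ≤ a → (t, c, k, v) ∈ Dom := by
    obtain ⟨r, hr, hrD⟩ := Metric.isOpen_iff.1 hT.opn _ hbase.1
    refine ⟨min (r / 2) (δ / 16), by positivity, min_le_right _ _, ?_⟩
    intro t c k v h1 h2 h3 h4 h5
    have hm := min_le_left (r / 2) (δ / 16)
    refine hT.I _ _ _ a _ (hrD ?_) h4 h5
    simp only [mem_ball, Prod.dist_eq, max_lt_iff, Real.dist_eq, sub_zero, sub_self, abs_zero]
    exact ⟨by linarith, by linarith, by linarith, hr⟩
  obtain ⟨v1, hv1⟩ : ∃ v1, v1 = 1 - δ / 2 := ⟨_, rfl⟩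
  obtain ⟨v2, hv2⟩ : ∃ v2, v2 = 1 - δ / 4 := ⟨_, rfl⟩
  obtain ⟨M, hMd⟩ : ∃ M, M = (m0 + η + 1) / η ^ 2 := ⟨_, rfl⟩
  have hM : 0 ≤ M := by rw [hMd]; positivity
  have hMη : M * η ^ 2 = m0 + η + 1 := by rw [hMd]; field_simp
  have hηa : |η| ≤ η := (abs_of_pos hη).le
  have v10 : 0 < v1 := by linarith
  have v20 : 0 < v2 := by linarith
  -- box membership
  have hbm : ∀ t c k v, |t| ≤ η → 0 ≤ c → c ≤ m0 + η → 0 ≤ k → k ≤ η → v1 ≤ v → v ≤ 1 + δ / 8 →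
      (arc c k v, t) ∈ W := by
    intro t c k v h1 h2 h3 h4 h5 h6 h7
    have := box_mem hδ hδ2 h2 (by linarith) h4 (by linarith) (by linarith) h7
    exact hbox _ _ this.1 this.2 (by linarith)
  -- agreement at (0, m0, η, v1)
  have hag : Y (0, m0, η, v1) = J (arc m0 η v1, 0) := by
    have := hT.agree hlh hJc hJO (t := fun _ => 0) (c := fun _ => m0) (k := fun s => s * η)
      (v := fun s => (1 - s) * a + s * v1) (by fun_prop) (by fun_prop) (by fun_prop) (by fun_prop)
      (fun s hs => by
        have hp := mul_nonneg hs.1 (by linarith : 0 ≤ a - v1)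
        have hp2 := mul_nonneg (sub_nonneg.2 hs.2) ha0.le
        have hp3 := mul_nonneg hs.1 v10.le
        refine hηD _ _ _ _ (by simpa using hη.le) (by simpa using hη.le) ?_ (by linarith)
          (by linarith)
        rw [abs_of_nonneg (mul_nonneg hs.1 hη.le)]
        exact mul_le_of_le_one_left hη.le hs.2)
      (fun s hs => by
        have hp := mul_nonneg hs.1 (by linarith : 0 ≤ a - v1)
        have hp2 := mul_nonneg (sub_nonneg.2 hs.2) (by linarith : 0 ≤ a - v1)
        exact hbm _ _ _ _ (by simpa using hη.le) m00 (by linarith) (mul_nonneg hs.1 hη.le)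
          (mul_le_of_le_one_left hη.le hs.2) (by linarith) (by linarith))
      (s0 := 0) (left_mem_Icc.2 zero_le_one) (by simpa using hbaseJ) 1
      (right_mem_Icc.2 zero_le_one)
    simpa using this
  -- main claim
  have hmain : ∀ c, 0 ≤ c → c ≤ m0 + η → (0, c, η, v2) ∈ Dom := by
    by_contra hcon
    push Not at hcon
    obtain ⟨c0, hc0, hc0', hc0D⟩ := hcon
    set Fail : Set (ℝ × ℝ) := (Icc (-η) η ×ˢ Icc 0 (m0 + η)) ∩
      (fun p : ℝ × ℝ => (p.1, p.2, η, v2)) ⁻¹' Domᶜ with hFail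
    have hFc : IsCompact Fail :=
      (isCompact_Icc.prod isCompact_Icc).inter_right
        (hT.opn.isClosed_compl.preimage (by fun_prop))
    have hF0 : ((0 : ℝ), c0) ∈ Fail := ⟨⟨⟨by linarith, hη.le⟩, hc0, hc0'⟩, hc0D⟩
    obtain ⟨⟨ts, D⟩, ⟨⟨htsI, hDI⟩, hDn⟩, hmax⟩ := hFc.exists_isMaxOn ⟨_, hF0⟩
      (f := fun p : ℝ × ℝ => p.2 - M * p.1 ^ 2) (Continuous.continuousOn (by fun_prop))
    have htsI' : ts ∈ Icc (-η) η := htsI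
    have hDI' : D ∈ Icc 0 (m0 + η) := hDI
    have hDn' : (ts, D, η, v2) ∉ Dom := hDn
    have hcs : 0 ≤ D - M * ts ^ 2 := by
      have := hmax hF0
      simp only [mem_ofPred_eq] at this
      refine le_trans ?_ this
      simpa using hc0
    have hts : |ts| < η := by
      by_contra hge
      have h1 : η ^ 2 ≤ |ts| ^ 2 := by
        have := not_lt.1 hge
        gcongr
      rw [sq_abs] at h1
      have h2 := mul_le_mul_of_nonneg_left h1 hM
      linarith [hDI'.2]
    have hDm : D < m0 - η := by
      by_contra hge
      refine hDn' (hηD _ _ _ _ hts.le ?_ hηa v20.le (by linarith))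
      rw [abs_le]
      constructor <;> linarith [hDI'.2]
    have hTT : ∀ t c, |t| ≤ η → 0 ≤ c → c ≤ m0 + η → D - M * ts ^ 2 < c - M * t ^ 2 →
        (t, c, η, v2) ∈ Dom := by
      intro t c h1 h2 h3 h4
      by_contra hn
      have : (t, c) ∈ Fail := ⟨⟨abs_le.1 h1, h2, h3⟩, hn⟩
      have := hmax this
      simp only [mem_ofPred_eq] at this
      linarith
    -- v1 fails
    have hv1D : (ts, D, η, v1) ∉ Dom := by
      intro hin
      have hpath : ∀ s ∈ Icc (0 : ℝ) 1, |s * ts| ≤ η ∧ 0 ≤ s * D + (1 - s) * m0 ∧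
          s * D + (1 - s) * m0 ≤ m0 + η := by
        intro s hs
        have p1 := mul_nonneg hs.1 (by linarith : 0 ≤ m0 - D)
        have p2 := mul_nonneg hs.1 hDI'.1
        have p3 := mul_nonneg (sub_nonneg.2 hs.2) m00
        refine ⟨?_, by linarith, by linarith⟩
        rw [abs_mul, abs_of_nonneg hs.1]
        exact (mul_le_of_le_one_left (abs_nonneg _) hs.2).trans hts.le
      have hYJ := hT.agree hlh hJc hJO (t := fun s => s * ts) (c := fun s => s * D + (1 - s) * m0)
        (k := fun _ => η) (v := fun _ => v1) (by fun_prop) (by fun_prop) (by fun_prop) (by fun_prop)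
        (fun s hs => by
          obtain ⟨p1, p2, p3⟩ := hpath s hs
          rcases eq_or_lt_of_le hs.2 with rfl | hs1
          · simpa using hin
          · refine hT.I _ _ _ _ _ (hTT _ _ p1 p2 p3 ?_) v10.le (by linarith)
            have q1 := mul_pos (sub_pos.2 hs1) (by linarith : 0 < m0 - D)
            have q2 : M * (s * ts) ^ 2 ≤ M * ts ^ 2 := by
              apply mul_le_mul_of_nonneg_left _ hM
              rw [mul_pow]
              exact mul_le_of_le_one_left (sq_nonneg _) (pow_le_one₀ hs.1 hs.2)
            linarith)
        (fun s hs => by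
          obtain ⟨p1, p2, p3⟩ := hpath s hs
          exact hbm _ _ _ _ p1 p2 p3 hη.le le_rfl le_rfl (by linarith))
        (s0 := 0) (left_mem_Icc.2 zero_le_one) (by simpa using hag) 1
        (right_mem_Icc.2 zero_le_one)
      simp only [one_mul, sub_self, zero_mul, add_zero] at hYJ
      have hWv : ∀ v ∈ Icc v1 v2, (arc D η v, ts) ∈ W := fun v hv =>
        hbm _ _ _ _ hts.le hDI'.1 hDI'.2 hη.le le_rfl hv.1 (by linarith [hv.2])
      have hac : Continuous fun v => (arc D η v, ts) :=
        (continuous_arc.comp (by fun_prop : Continuous fun v : ℝ => (D, η, v))).prodMk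
          continuous_const
      have := LiftTo.glue (A := fun r => (arc D η r, ts)) v10 (by linarith : v1 ≤ v2)
        (hT.L _ _ _ _ hin) (k := fun v => J (arc D η v, ts))
        (hJc.comp hac.continuousOn hWv) hYJ.symm (fun v hv => hJO _ (hWv v hv))
      exact hDn' (hT.U _ _ _ _ _ this).1
    -- first failing time
    have hcomp : IsCompact (Icc 0 v1 ∩ (fun v => (ts, D, η, v)) ⁻¹' Domᶜ) :=
      isCompact_Icc.inter_right (hT.opn.isClosed_compl.preimage (by fun_prop))
    obtain ⟨vs, ⟨hvsI, hvsD⟩, hmin⟩ := hcomp.exists_isLeast ⟨v1, ⟨v10.le, le_rfl⟩, hv1D⟩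
    have hvsD' : (ts, D, η, vs) ∉ Dom := hvsD
    have htsε : |ts| < ε := by
      have := hT.F _ _ _ _ (hηD ts m0 η 0 hts.le (by simpa using hη.le) hηa le_rfl ha0.le)
      have h2 : (Y (ts, m0, η, 0)).2 = ts := congrArg Prod.snd this.2
      have h3 : |(Y (ts, m0, η, 0)).2| < ε := this.1
      rwa [h2] at h3
    have h0D : (ts, D, η, 0) ∈ Dom := by
      refine (hT.U _ _ _ _ (0, ts) ⟨fun _ => (0, ts), continuousOn_const, rfl, rfl,
        fun s _ => ⟨htsε, ?_⟩⟩).1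
      simp [Phi, hX0, arc]
    have hvs : 0 < vs := by
      rcases eq_or_lt_of_le hvsI.1 with h | h
      · rw [← h] at hvsD'; exact absurd h0D hvsD'
      · exact h
    have hd : ∀ v, 0 ≤ v → v < vs → (ts, D, η, v) ∈ Dom := by
      intro v h1 h2
      by_contra hn
      have := hmin ⟨⟨h1, h2.le.trans hvsI.2⟩, hn⟩
      linarith
    obtain ⟨R, hR⟩ := escape hlh hT.cont hT.F hT.I (m0 := m0) (v1 := v1) (v2 := v2) hη (by linarith)
      hM hDI'.1 (by linarith) hDm hcs hts hvs hvsI.2 (by linarith) (by linarith) hTT hd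
    have hac : Continuous fun v => (arc D η v, ts) :=
      (continuous_arc.comp (by fun_prop : Continuous fun v : ℝ => (D, η, v))).prodMk
        continuous_const
    obtain ⟨y, hy⟩ := hlh.extend (x := ((0 : ℂ), ts)) (A := fun v => (arc D η v, ts)) hac hvs
      (isCompact_closedBall (0 : ℂ × ℝ) R)
      (by
        intro y _ hy
        have : y.2 = ts := congrArg Prod.snd hy
        change |y.2| < ε
        rw [this]; exact htsε)
      (by
        apply Eventually.frequently
        filter_upwards [Ioo_mem_nhdsLT (by linarith : vs / 2 < vs)] with v hv
        exact ⟨Y (ts, D, η, v), by simpa using hR v hv,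
          hT.L _ _ _ _ (hd v (by linarith [hv.1]) hv.2)⟩)
    exact hvsD' (hT.U _ _ _ _ _ hy).1
  -- conclusion
  have hηv : ∀ v, 0 ≤ v → v ≤ v1 → 0 ≤ η * v ∧ η * v ≤ m0 + η := by
    intro v h1 h2
    have := mul_nonneg hη.le h1
    have := mul_nonneg hη.le (by linarith : 0 ≤ 1 - v)
    exact ⟨by linarith, by linarith⟩
  have harc2 : ∀ v, arc (η * v) η v = (v : ℂ) := by
    intro v
    apply Complex.ext
    · rw [arc_re]; simp
    · rw [arc_im]; simp; ring
  have hgD : ∀ v, 0 ≤ v → v ≤ v1 → (0, η * v, η, v) ∈ Dom := fun v h1 h2 =>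
    hT.I _ _ _ v2 _ (hmain _ (hηv v h1 h2).1 (hηv v h1 h2).2) h1 (by linarith)
  have hsv : ∀ s ∈ Icc (0 : ℝ) 1, 0 ≤ s * v1 ∧ s * v1 ≤ v1 := fun s hs =>
    ⟨mul_nonneg hs.1 v10.le, mul_le_of_le_one_left v10.le hs.2⟩
  have hY0 : Y (0, η * 0, η, 0) = (0, 0) := by
    refine (hT.U _ _ _ _ _ ⟨fun _ => (0, 0), continuousOn_const, rfl, rfl, fun s _ => ⟨?_, ?_⟩⟩).2
    · simpa [Om] using hε
    · simp [Phi, hX0, arc]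
  have hl1 : LiftTo (Phi X) (Om ε) (0, 0) (fun s => (fun r : ℝ => ((r : ℂ), (0 : ℝ))) (s * v1))
      (Y (0, η * v1, η, v1)) := by
    refine ⟨fun s => Y (0, η * (s * v1), η, s * v1), ?_, ?_, ?_, ?_⟩
    · exact hT.cont.comp (Continuous.continuousOn (by fun_prop))
        fun s hs => hgD _ (hsv s hs).1 (hsv s hs).2
    · simpa using hY0
    · simp
    · intro s hs
      have := hT.F _ _ _ _ (hgD _ (hsv s hs).1 (hsv s hs).2)
      rw [harc2] at this
      exact this
  have hYv1 : Y (0, η * v1, η, v1) = J (arc (η * v1) η v1, 0) := by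
    have hcv : ∀ s ∈ Icc (0 : ℝ) 1, 0 ≤ s * (η * v1) + (1 - s) * m0 ∧
        s * (η * v1) + (1 - s) * m0 ≤ m0 + η := by
      intro s hs
      obtain ⟨p1, p2⟩ := hηv v1 v10.le le_rfl
      have q1 := mul_nonneg hs.1 p1
      have q2 := mul_nonneg (sub_nonneg.2 hs.2) m00
      have q3 := mul_nonneg hs.1 (sub_nonneg.2 p2)
      have q4 := mul_nonneg (sub_nonneg.2 hs.2) hη.le
      exact ⟨by linarith, by linarith⟩
    have := hT.agree hlh hJc hJO (t := fun _ => 0) (c := fun s => s * (η * v1) + (1 - s) * m0)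
      (k := fun _ => η) (v := fun _ => v1) (by fun_prop) (by fun_prop) (by fun_prop) (by fun_prop)
      (fun s hs => hT.I _ _ _ _ _ (hmain _ (hcv s hs).1 (hcv s hs).2) v10.le (by linarith))
      (fun s hs => hbm _ _ _ _ (by simpa using hη.le) (hcv s hs).1 (hcv s hs).2 hη.le le_rfl le_rfl
        (by linarith))
      (s0 := 0) (left_mem_Icc.2 zero_le_one) (by simpa using hag) 1
      (right_mem_Icc.2 zero_le_one)
    simpa using this
  rw [harc2] at hYv1
  have hWv : ∀ v ∈ Icc v1 1, ((v : ℂ), (0 : ℝ)) ∈ W := by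
    intro v hv
    refine hbox _ _ ?_ (by simpa using hδ) (by simpa using hδ)
    simp only [Complex.ofReal_re]
    rw [abs_lt]
    constructor <;> linarith [hv.1, hv.2]
  have := LiftTo.glue (A := fun r : ℝ => ((r : ℂ), (0 : ℝ))) v10 (by linarith : v1 ≤ 1) hl1
    (k := fun v : ℝ => J ((v : ℂ), 0)) (hJc.comp (Continuous.continuousOn (by fun_prop)) hWv)
    hYv1.symm (fun v hv => hJO _ (hWv v hv))
  unfold InV
  simpa [hz, hJ1] using this


theorem InV.conj {X : ℂ → ℂ} {ε : ℝ} {z : ℂ} (L : ℂ ≃L[ℝ] ℂ) (h : InV X ε z) :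
    InV (fun u => L (X (L.symm u))) ε (L z) := by
  obtain ⟨g, c, e0, e1, m⟩ := h
  have hsm : ∀ (t : ℝ) (u : ℂ), L ((t : ℂ) * u) = (t : ℂ) * L u := by
    intro t u
    rw [← Complex.real_smul, ← Complex.real_smul, map_smul]
  refine ⟨fun s => (L (g s).1, (g s).2), ?_, by simp [e0], by simp [e1], ?_⟩
  · exact (L.continuous.comp_continuousOn (continuous_fst.comp_continuousOn c)).prodMk
      (continuous_snd.comp_continuousOn c)
  · intro s hs
    obtain ⟨h1, h2⟩ := m s hs
    refine ⟨h1, ?_⟩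
    have a1 : X (g s).1 - ((g s).2 : ℂ) * (g s).1 = (s : ℂ) * X z := congrArg Prod.fst h2
    have a2 : (g s).2 = 0 := congrArg Prod.snd h2
    refine Prod.ext ?_ a2
    change L (X (L.symm (L (g s).1))) - ((g s).2 : ℂ) * L (g s).1 = (s : ℂ) * L (X (L.symm (L z)))
    rw [L.symm_apply_apply, L.symm_apply_apply, ← hsm, ← hsm, ← map_sub, a1]

/-- two-sided hypothesis -/
def TS (X : ℂ → ℂ) (ε : ℝ) : Prop :=
  ∃ X' : ℂ → ℂ →L[ℝ] ℂ, (∀ z, HasFDerivAt X (X' z) z) ∧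
    ∀ z v, ∀ t : ℝ, |t| < ε → X' z v = t • v → v = 0

theorem TS.conj {X : ℂ → ℂ} {ε : ℝ} (L : ℂ ≃L[ℝ] ℂ) (h : TS X ε) :
    TS (fun u => L (X (L.symm u))) ε := by
  obtain ⟨X', h1, h2⟩ := h
  refine ⟨fun u => (L : ℂ →L[ℝ] ℂ).comp ((X' (L.symm u)).comp (L.symm : ℂ →L[ℝ] ℂ)), ?_, ?_⟩
  · intro u
    exact (L.hasFDerivAt).comp u ((h1 _).comp u L.symm.hasFDerivAt)
  · intro z v t ht hv
    have : X' (L.symm z) (L.symm v) = t • L.symm v := by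
      apply L.injective
      rw [map_smul, L.apply_symm_apply]
      exact hv
    have := h2 _ _ t ht this
    simpa using this

theorem TS.lh {X : ℂ → ℂ} {ε : ℝ} (h : TS X ε) : LH (Phi X) (Om ε) := by
  obtain ⟨X', h1, h2⟩ := h
  have hO : IsOpen (Om ε) := isOpen_lt (by fun_prop) continuous_const
  refine LH_of_inj (f' := fun p => (((X' p.1).comp (ContinuousLinearMap.fst ℝ ℂ ℝ)) -
      (((p.2 : ℂ) • ContinuousLinearMap.fst ℝ ℂ ℝ) +
        ((Complex.ofRealCLM.comp (ContinuousLinearMap.snd ℝ ℂ ℝ)).smulRight p.1))).prod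
      (ContinuousLinearMap.snd ℝ ℂ ℝ)) hO ?_ ?_
  · intro p
    refine HasFDerivAt.prodMk ?_ hasFDerivAt_snd
    refine HasFDerivAt.sub ((h1 p.1).comp p hasFDerivAt_fst) ?_
    have h3 := (Complex.ofRealCLM.hasFDerivAt.comp p (hasFDerivAt_snd (𝕜 := ℝ) (p := p))).mul
      (hasFDerivAt_fst (𝕜 := ℝ) (p := p))
    refine HasFDerivAt.congr_fderiv (f := fun p : ℂ × ℝ => (p.2 : ℂ) * p.1) h3 ?_
    apply ContinuousLinearMap.ext
    rintro ⟨u, τ⟩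
    simp [mul_comm]
  · intro p hp
    rw [injective_iff_map_eq_zero]
    rintro ⟨u, τ⟩ hu
    have hτ : τ = 0 := congrArg Prod.snd hu
    subst hτ
    have h3 := congrArg Prod.fst hu
    simp at h3
    have := h2 p.1 u p.2 hp (by rw [Complex.real_smul]; exact sub_eq_zero.1 h3)
    simp [this]

theorem V_closed {X : ℂ → ℂ} {ε : ℝ} (hε : 0 < ε) (h : TS X ε) (hX0 : X 0 = 0) {z : ℂ}
    (hz : ∃ᶠ z' in 𝓝 z, InV X ε z') : InV X ε z := by
  have hlh := h.lh
  by_cases hw : X z = 0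
  · -- image zero
    have hzO : (z, (0 : ℝ)) ∈ Om ε := by simpa [Om] using hε
    obtain ⟨U, hUo, hzU, hUO, -, hWo, J, hJc, hJU, hJl⟩ := hlh.inverse hzO univ_mem
    have hPz : Phi X (z, 0) = (0, 0) := by simp [Phi, hw]
    have h0W : ((0 : ℂ), (0 : ℝ)) ∈ Phi X '' U := ⟨_, hzU, hPz⟩
    obtain ⟨r, hr, hrW⟩ := Metric.isOpen_iff.1 hWo _ h0W
    have hXc : Continuous X := by
      have : X = fun z => (Phi X (z, 0)).1 := by funext z; simp [Phi]
      rw [this]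
      exact continuous_fst.comp (hlh.cont.comp (by fun_prop))
    have ev1 : ∀ᶠ z' in 𝓝 z, (z', (0 : ℝ)) ∈ U :=
      ((Continuous.prodMk_left (0 : ℝ)).continuousAt (x := z)).eventually (hUo.mem_nhds hzU)
    have ev2 : ∀ᶠ z' in 𝓝 z, ‖X z'‖ < r := by
      have : Tendsto (fun z' => ‖X z'‖) (𝓝 z) (𝓝 ‖X z‖) :=
        (Continuous.tendsto (by fun_prop) z)
      exact this.eventually_lt_const (by simpa [hw] using hr)
    obtain ⟨z', ⟨g, c, e0, e1, m⟩, hzU', hzr⟩ := (hz.and_eventually (ev1.and ev2)).exists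
    have hWs : ∀ s ∈ Icc (0 : ℝ) 1, ((s : ℂ) * X z', (0 : ℝ)) ∈ Phi X '' U := by
      intro s hs
      apply hrW
      rw [mem_ball, Prod.dist_eq, max_lt_iff]
      refine ⟨?_, by simpa using hr⟩
      simp only [dist_zero_right, norm_mul, Complex.norm_real, Real.norm_eq_abs,
        abs_of_nonneg hs.1]
      exact (mul_le_of_le_one_left (norm_nonneg _) hs.2).trans_lt hzr
    have := hlh.unique isPreconnected_Icc (g1 := g) (g2 := fun s : ℝ => J ((s : ℂ) * X z', 0)) c
      (hJc.comp (Continuous.continuousOn (by fun_prop)) hWs) (fun s hs => (m s hs).1)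
      (fun s hs => hUO (hJU _ (hWs s hs)).1)
      (fun s hs => by rw [(m s hs).2, (hJU _ (hWs s hs)).2])
      (a0 := 1) (right_mem_Icc.2 zero_le_one)
      (by
        have hP : Phi X (z', 0) = (X z', 0) := by simp [Phi]
        simp only [Complex.ofReal_one, one_mul]
        rw [e1, ← hP, hJl _ hzU']) 0 (left_mem_Icc.2 zero_le_one)
    rw [e0] at this
    simp only [Complex.ofReal_zero, zero_mul] at this
    have hJ0 : J (0, 0) = (z, 0) := by rw [← hPz, hJl _ hzU]
    rw [hJ0] at this
    have hz0 : z = 0 := (congrArg Prod.fst this).symm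
    subst hz0
    exact ⟨fun _ => (0, 0), continuousOn_const, rfl, rfl, fun s _ => ⟨hzO, by simp [Phi, hX0]⟩⟩
  · obtain ⟨L, hL⟩ : ∃ L : ℂ ≃L[ℝ] ℂ, ∀ u, L u = (X z)⁻¹ * u :=
      ⟨((LinearEquiv.smulOfNeZero ℂ ℂ (X z)⁻¹ (inv_ne_zero hw)).restrictScalars ℝ
        ).toContinuousLinearEquiv, fun u => by simp⟩
    have key : ∀ L : ℂ ≃L[ℝ] ℂ, L (X z) = 1 →
        (∃ᶠ z' in 𝓝 z, InV X ε z' ∧ 0 ≤ (L (X z')).im) → InV X ε z := by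
      intro L hL1 hf
      have h1 : InV (fun u => L (X (L.symm u))) ε (L z) := by
        refine lemmaK hε (h.conj L).lh (by simp [hX0]) (by simpa using hL1) ?_
        refine (L.continuous.tendsto z).frequently (hf.mono ?_)
        rintro z' ⟨k1, k2⟩
        exact ⟨k1.conj L, by simpa using k2⟩
      have h2 := h1.conj L.symm
      simpa using h2
    have h3 : ∃ᶠ z' in 𝓝 z, (InV X ε z' ∧ 0 ≤ (L (X z')).im) ∨
        (InV X ε z' ∧ 0 ≤ ((L.trans Complex.conjCLE) (X z')).im) := by
      refine hz.mono fun z' hz' => ?_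
      rcases le_total 0 (L (X z')).im with h | h
      · exact Or.inl ⟨hz', h⟩
      · exact Or.inr ⟨hz', by simpa using h⟩
    rw [frequently_or_distrib] at h3
    have hL1 : L (X z) = 1 := by rw [hL, inv_mul_cancel₀ hw]
    rcases h3 with h3 | h3
    · exact key L hL1 h3
    · exact key _ (by simp [hL1]) h3

theorem V_open {X : ℂ → ℂ} {ε : ℝ} (hε : 0 < ε) (h : TS X ε) (hX0 : X 0 = 0) {z : ℂ}
    (hz : InV X ε z) : ∀ᶠ z' in 𝓝 z, InV X ε z' := by
  have hlh := h.lh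
  have hXc : Continuous X := by
    have : X = fun z => (Phi X (z, 0)).1 := by funext z; simp [Phi]
    rw [this]
    exact continuous_fst.comp (hlh.cont.comp (by fun_prop))
  have hzO : (z, (0 : ℝ)) ∈ Om ε := by simpa [Om] using hε
  obtain ⟨W, hW, hi⟩ := hlh.inj _ hzO
  have h1 := hlh.tube_aux (σ := fun _ : ℂ => ((0 : ℂ), (0 : ℝ)))
    (γ := fun z' s => ((s : ℂ) * X z', (0 : ℝ))) continuous_const
    (by
      change Continuous fun p : ℂ × ℝ => ((p.2 : ℂ) * X p.1, (0 : ℝ))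
      fun_prop) (by simp [Phi, hX0]) hz hW
  have ev1 : ∀ᶠ z' in 𝓝 z, (z', (0 : ℝ)) ∈ W :=
    ((Continuous.prodMk_left (0 : ℝ)).continuousAt (x := z)).eventually hW
  filter_upwards [h1, ev1] with z' ⟨y, hyW, hy⟩ hz'
  have hy' := hy
  obtain ⟨g, -, -, e1, m⟩ := hy
  have h2 := (m 1 (right_mem_Icc.2 zero_le_one)).2
  rw [e1] at h2
  have : y = (z', 0) := hi hyW hz' (by rw [h2]; simp [Phi])
  rw [this] at hy'
  exact hy'

theorem two_sided_zero {X : ℂ → ℂ} {ε : ℝ} (hε : 0 < ε) (h : TS X ε) (hX0 : X 0 = 0) {q : ℂ}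
    (hq : X q = 0) : q = 0 := by
  have h0 : InV X ε 0 := ⟨fun _ => (0, 0), continuousOn_const, rfl, rfl, fun s _ =>
    ⟨by simpa [Om] using hε, by simp [Phi, hX0]⟩⟩
  have hcl : IsClopen {z | InV X ε z} := by
    constructor
    · refine isClosed_of_closure_subset fun z hz => ?_
      exact V_closed hε h hX0 (mem_closure_iff_frequently.1 hz)
    · exact isOpen_iff_eventually.2 fun z hz => V_open hε h hX0 hz
  have huniv := hcl.eq_univ ⟨0, h0⟩
  have hqV : InV X ε q := by
    have : q ∈ {z | InV X ε z} := by rw [huniv]; trivial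
    exact this
  have h1 : LiftTo (Phi X) (Om ε) (0, 0) (fun s => ((s : ℂ) * X q, 0)) (0, 0) :=
    ⟨fun _ => (0, 0), continuousOn_const, rfl, rfl, fun s _ =>
      ⟨by simpa [Om] using hε, by simp [Phi, hX0, hq]⟩⟩
  exact congrArg Prod.fst (h.lh.lift_unique hqV h1)

theorem two_sided {X : ℂ → ℂ} {ε : ℝ} (hε : 0 < ε) (h : TS X ε) : Injective X := by
  intro p q hpq
  obtain ⟨X', h1, h2⟩ := h
  have hT : TS (fun u => X (u + q) - X q) ε := by
    refine ⟨fun u => X' (u + q), fun z => ?_, fun z => h2 _⟩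
    have := (h1 (z + q)).comp z ((hasFDerivAt_id z).add_const q)
    simpa using this.sub_const (X q)
  have := two_sided_zero hε hT (q := p - q) (by simp) (by simp [hpq])
  exact sub_eq_zero.1 this


theorem one_near {X : ℂ → ℂ} {X' : ℂ → ℂ →L[ℝ] ℂ} {ε : ℝ} (hε : 0 < ε)
    (h1 : ∀ z, HasFDerivAt X (X' z) z)
    (h2 : ∀ z v, ∀ t : ℝ, 0 ≤ t → t < ε → X' z v = t • v → v = 0) (p : ℂ) {r0 : ℝ} (hr0 : 0 < r0) :
    ∃ s0 > 0, ∀ s : ℝ, 0 ≤ s → s < s0 → s < ε → ∃ y ∈ ball p r0, X y - s • y = X p := by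
  have hi : Injective (X' p) := by
    rw [injective_iff_map_eq_zero]
    intro v hv
    exact h2 p v 0 le_rfl hε (by rw [hv, zero_smul])
  obtain ⟨k, hk⟩ := quant_inj (h1 p) hi
  have hk1 : (0 : ℝ) < 1 / ((k : ℝ) + 1) := by positivity
  obtain ⟨r, hr, hr1, hr2⟩ : ∃ r, 0 < r ∧ r < 1 / ((k : ℝ) + 1) ∧ r ≤ r0 :=
    ⟨min (1 / ((k : ℝ) + 1) / 2) r0, by positivity,
      (min_le_left _ _).trans_lt (half_lt_self hk1), min_le_right _ _⟩
  refine ⟨r / ((k : ℝ) + 1) / (2 * ‖p‖ + r), by positivity, ?_⟩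
  intro s hs hs0 hsε
  rw [lt_div_iff₀ (by positivity)] at hs0
  obtain ⟨y, hy, hy2⟩ := min_lemma (f := fun y => X y - s • y)
    (f' := fun y => X' y - s • ContinuousLinearMap.id ℝ ℂ) (p := p) (w := X p) hr
    (fun y _ => (h1 y).sub ((hasFDerivAt_id y).const_smul s))
    (fun y _ => by
      have : Injective (X' y - s • ContinuousLinearMap.id ℝ ℂ) := by
        rw [injective_iff_map_eq_zero]
        intro v hv
        exact h2 y v s hs hsε (sub_eq_zero.1 (by simpa using hv))
      exact LinearMap.injective_iff_surjective (f := (X' y - s • ContinuousLinearMap.id ℝ ℂ :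
        ℂ →L[ℝ] ℂ).toLinearMap).1 this)
    (fun y hy => by
      have hyr : ‖y - p‖ = r := by simpa [dist_eq_norm] using hy
      have h3 := hk y (by rw [hyr]; exact hr1)
      rw [hyr] at h3
      have h4 : r / ((k : ℝ) + 1) ≤ ‖X y - X p‖ := by
        rw [div_le_iff₀ (by positivity)]; linarith
      have h5 : ‖X p - s • p - X p‖ = s * ‖p‖ := by
        rw [show X p - s • p - X p = -(s • p) by ring, norm_neg, norm_smul, Real.norm_eq_abs,
          abs_of_nonneg hs]
      have h6 : ‖X y - X p‖ ≤ ‖X y - s • y - X p‖ + s * ‖y‖ := by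
        have : X y - X p = (X y - s • y - X p) + s • y := by ring
        have hn : ‖s • y‖ = s * ‖y‖ := by rw [norm_smul, Real.norm_eq_abs, abs_of_nonneg hs]
        calc ‖X y - X p‖ = ‖(X y - s • y - X p) + s • y‖ := by rw [← this]
          _ ≤ _ := (norm_add_le _ _).trans_eq (by rw [hn])
      have h7 : ‖y‖ ≤ ‖p‖ + r := by
        have := norm_add_le p (y - p)
        rw [hyr] at this
        simpa using this
      have h8 := mul_le_mul_of_nonneg_left h7 hs
      rw [h5]
      linarith)
  exact ⟨y, ball_subset_ball hr2 hy, hy2⟩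

theorem one_sided {X : ℂ → ℂ} {X' : ℂ → ℂ →L[ℝ] ℂ} {ε : ℝ} (hε : 0 < ε)
    (h1 : ∀ z, HasFDerivAt X (X' z) z)
    (h2 : ∀ z v, ∀ t : ℝ, 0 ≤ t → t < ε → X' z v = t • v → v = 0) : Injective X := by
  intro p q hpq
  by_contra hne
  have hd : 0 < dist p q / 2 := by
    have := dist_pos.2 hne
    linarith
  obtain ⟨s1, hs1, H1⟩ := one_near hε h1 h2 p hd
  obtain ⟨s2, hs2, H2⟩ := one_near hε h1 h2 q hd
  obtain ⟨s, hs, hs0⟩ := exists_between (lt_min (lt_min hs1 hs2) hε)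
  rw [lt_min_iff, lt_min_iff] at hs0
  obtain ⟨y1, hy1, e1⟩ := H1 s hs.le hs0.1.1 hs0.2
  obtain ⟨y2, hy2, e2⟩ := H2 s hs.le hs0.1.2 hs0.2
  have hTS : TS (fun y => X y - s • y) (min s (ε - s)) := by
    refine ⟨fun y => X' y - s • ContinuousLinearMap.id ℝ ℂ,
      fun y => (h1 y).sub ((hasFDerivAt_id y).const_smul s), ?_⟩
    intro y v t ht hv
    rw [lt_min_iff, abs_lt, abs_lt] at ht
    refine h2 y v (s + t) (by linarith [ht.1.1]) (by linarith [ht.2.2]) ?_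
    have hv' : X' y v - s • v = t • v := hv
    rw [add_smul, ← hv']; ring
  have hy : y1 = y2 := two_sided (lt_min hs (sub_pos.2 hs0.2)) hTS (by
    change X y1 - s • y1 = X y2 - s • y2
    rw [e1, e2, hpq])
  subst hy
  rw [mem_ball, dist_comm] at hy1
  rw [mem_ball] at hy2
  have := dist_triangle p y1 q
  linarith

theorem eig_of_vec (L : Plane →L[ℝ] Plane) {v : Plane} (hv : v ≠ 0) {s : ℝ} (h : L v = s • v) :
    IsEigenvalueCLM L (s : ℂ) := by
  unfold IsEigenvalueCLM
  have he : Module.End.HasEigenvalue (L.toLinearMap : Module.End ℝ Plane) s :=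
    Module.End.hasEigenvalue_of_hasEigenvector
      (x := v) ⟨Module.End.mem_eigenspace_iff.2 h, hv⟩
  have hr := (Module.End.hasEigenvalue_iff_isRoot_charpoly _ _).1 he
  rw [Matrix.charpoly_map, LinearMap.charpoly_toMatrix]
  exact hr.map (f := algebraMap ℝ ℂ)

/-- A differentiable map of the plane with `Spec(f) ∩ [1, 1+ε) = ∅` has at most one
fixed point: `Fix(f)` is empty or a single point. -/
theorem stmt3 (f : Plane → Plane) (Df : Plane → Plane →L[ℝ] Plane)
    (hdiff : ∀ p : Plane, HasFDerivAt f (Df p) p)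
    (ε : ℝ) (hε : 0 < ε)
    (hspec : spec Df ∩ (Complex.ofReal '' Ico (1 : ℝ) (1 + ε)) = ∅) :
    {p : Plane | f p = p} = ∅ ∨ ∃ p₀ : Plane, {p : Plane | f p = p} = {p₀} := by
  obtain ⟨e⟩ : Nonempty (Plane ≃L[ℝ] ℂ) :=
    ⟨Complex.orthonormalBasisOneI.repr.symm.toContinuousLinearEquiv⟩
  have hinj : Injective (fun u : ℂ => e (f (e.symm u) - e.symm u)) := by
    refine one_sided (X' := fun u => (e : Plane →L[ℝ] ℂ).comp
      (((Df (e.symm u)).comp (e.symm : ℂ →L[ℝ] Plane)) - (e.symm : ℂ →L[ℝ] Plane))) hε ?_ ?_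
    · intro u
      exact e.hasFDerivAt.comp u
        (((hdiff _).comp u e.symm.hasFDerivAt).sub e.symm.hasFDerivAt)
    · intro u v t ht0 ht hv
      by_contra hne
      have hv0 : e.symm v ≠ 0 := by simpa using hne
      have h1 : Df (e.symm u) (e.symm v) = (1 + t) • e.symm v := by
        have h2 : e (Df (e.symm u) (e.symm v) - e.symm v) = t • v := hv
        have h3 : Df (e.symm u) (e.symm v) - e.symm v = t • e.symm v := by
          apply e.injective
          rw [h2, map_smul, e.apply_symm_apply]
        rw [add_smul, one_smul, ← h3]
        abel
      have hmem : ((1 + t : ℝ) : ℂ) ∈ spec Df ∩ (Complex.ofReal '' Ico (1 : ℝ) (1 + ε)) :=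
        ⟨⟨_, eig_of_vec _ hv0 h1⟩, 1 + t, ⟨by linarith, by linarith⟩, rfl⟩
      rw [hspec] at hmem
      exact hmem
  rcases Set.eq_empty_or_nonempty {p : Plane | f p = p} with h | ⟨p₀, h0⟩
  · exact Or.inl h
  · refine Or.inr ⟨p₀, Set.eq_singleton_iff_unique_mem.2 ⟨h0, fun q hq => ?_⟩⟩
    have h0' : f p₀ = p₀ := h0
    have hq' : f q = q := hq
    have := @hinj (e q) (e p₀) (by simp [h0', hq'])
    exact e.injective this
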